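/- For every k ∈ ℤ, t ≥ 0, and exponents 1 ≤ p ≤ q ≤ ∞ with 1/p + 1/q = 1, every u ∈ L^p(𝕋_R) satisfies ‖P_k e^{−itΛ} u‖_{L^q} ≲ [(1+t)^{−1}·(t/R+1)²·2^{2k⁺}]^{1/p − 1/q} ‖u‖_{L^p}, with an implicit constant independent of k, t, R, u. -/

import Mathlib

/-!
Common framework: functions on the torus `𝕋_R = (ℝ/Rℤ)²` are modelled as
`R`-periodic functions on `ℝ²`; Fourier multipliers are defined through the
Fourier coefficients on the frequency lattice `(2πℤ/R)²`.
-/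

noncomputable section

open MeasureTheory Real Set
open scoped ENNReal NNReal

abbrev T2 : Type := ℝ × ℝ

namespace EP

/-- Euclidean dot product on ℝ². -/
def dot2 (x y : T2) : ℝ := x.1 * y.1 + x.2 * y.2

/-- Euclidean norm on ℝ². -/
def en (x : T2) : ℝ := Real.sqrt (dot2 x x)

/-- A point of the lattice (Rℤ)². -/
def lat (R : ℝ) (k : ℤ × ℤ) : T2 := (R * (k.1 : ℝ), R * (k.2 : ℝ))

/-- A point of the frequency lattice (2πℤ/R)². -/
def freq (R : ℝ) (k : ℤ × ℤ) : T2 := (2 * π * (k.1 : ℝ) / R, 2 * π * (k.2 : ℝ) / R)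

/-- R-periodicity (function on the torus of size R). -/
def PeriodicC (R : ℝ) (u : T2 → ℂ) : Prop := ∀ (x : T2) (k : ℤ × ℤ), u (x + lat R k) = u x

def PeriodicR (R : ℝ) (u : T2 → ℝ) : Prop := ∀ (x : T2) (k : ℤ × ℤ), u (x + lat R k) = u x

/-- A fundamental domain for the torus. -/
def box (R : ℝ) : Set T2 := Ioc (0:ℝ) R ×ˢ Ioc (0:ℝ) R

/-- Lebesgue measure on the fundamental domain. -/
def μbox (R : ℝ) : Measure T2 := volume.restrict (box R)

/-- Fourier coefficient û(ξ) at ξ = freq R k. -/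
def fCoeff (R : ℝ) (u : T2 → ℂ) (k : ℤ × ℤ) : ℂ :=
  ∫ x in box R, u x * Complex.exp (-Complex.I * ((dot2 x (freq R k) : ℝ) : ℂ))

/-- Fourier multiplier with symbol m. -/
def op (R : ℝ) (m : T2 → ℂ) (u : T2 → ℂ) : T2 → ℂ := fun x =>
  (1 / (R : ℂ) ^ 2) * ∑' k : ℤ × ℤ,
    m (freq R k) * fCoeff R u k * Complex.exp (Complex.I * ((dot2 x (freq R k) : ℝ) : ℂ))

/-- L^p norm on the torus (valued in ℝ≥0∞). -/
def LpE (R : ℝ) (p : ℝ≥0∞) (u : T2 → ℂ) : ℝ≥0∞ := eLpNorm u p (μbox R)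

/-- Λ(ξ) = √(1+|ξ|²). -/
def lam (ξ : T2) : ℝ := Real.sqrt (1 + dot2 ξ ξ)

/-- The operator Λ^s. -/
def lamPow (R : ℝ) (s : ℝ) (u : T2 → ℂ) : T2 → ℂ :=
  op R (fun ξ => ((lam ξ ^ s : ℝ) : ℂ)) u

/-- H^s norm: ‖Λ^s u‖_{L²}. -/
def HNe (R : ℝ) (s : ℝ) (u : T2 → ℂ) : ℝ≥0∞ := LpE R 2 (lamPow R s u)

/-- Complexification of a real function. -/
def cf (u : T2 → ℝ) : T2 → ℂ := fun x => (u x : ℂ)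

/-- |∇|^{-1} (acting as 0 on the zero frequency). -/
def invGrad (R : ℝ) (u : T2 → ℂ) : T2 → ℂ := op R (fun ξ => (((en ξ)⁻¹ : ℝ) : ℂ)) u

/-- |∇|. -/
def absGrad (R : ℝ) (u : T2 → ℂ) : T2 → ℂ := op R (fun ξ => ((en ξ : ℝ) : ℂ)) u

/-- Λ|∇|^{-1}. -/
def LamInvGrad (R : ℝ) (u : T2 → ℂ) : T2 → ℂ :=
  op R (fun ξ => ((lam ξ * (en ξ)⁻¹ : ℝ) : ℂ)) u

/-- The linear propagator e^{itΛ}. -/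
def flow (R : ℝ) (t : ℝ) (u : T2 → ℂ) : T2 → ℂ :=
  op R (fun ξ => Complex.exp (Complex.I * (t : ℂ) * ((lam ξ : ℝ) : ℂ))) u

/-- U = Λ|∇|^{-1}ρ + i|∇|h. -/
def Ufun (R : ℝ) (ρ h : T2 → ℝ) : T2 → ℂ := fun x =>
  LamInvGrad R (cf ρ) x + Complex.I * absGrad R (cf h) x

/-- Partial derivatives on ℝ². -/
def d1 (f : T2 → ℝ) (x : T2) : ℝ := fderiv ℝ f x ((1:ℝ), (0:ℝ))
def d2 (f : T2 → ℝ) (x : T2) : ℝ := fderiv ℝ f x ((0:ℝ), (1:ℝ))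
def grad2 (f : T2 → ℝ) (x : T2) : T2 := (d1 f x, d2 f x)
def div2 (v : T2 → T2) (x : T2) : ℝ := d1 (fun y => (v y).1) x + d2 (fun y => (v y).2) x
def lap2 (f : T2 → ℝ) (x : T2) : ℝ := d1 (d1 f) x + d2 (d2 f) x

/-- The Euler–Poisson system on the torus of size `R`, on the time interval `[0, T]`,
for an irrotational velocity `v = ∇h`: `ρ_t + ∇·((1+ρ)v) = 0`,
`v_t + (v·∇)v + ∇ρ = ∇φ`, `Δφ = ρ`, with charge neutrality and zero momentum. -/
structure IsEPSol (R T : ℝ) (ρ h φp : ℝ → T2 → ℝ) : Prop where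
  per_rho : ∀ t ∈ Icc (0:ℝ) T, PeriodicR R (ρ t)
  per_h : ∀ t ∈ Icc (0:ℝ) T, PeriodicR R (h t)
  per_phi : ∀ t ∈ Icc (0:ℝ) T, PeriodicR R (φp t)
  reg_rho : ∀ t ∈ Icc (0:ℝ) T, ContDiff ℝ 1 (ρ t)
  reg_h : ∀ t ∈ Icc (0:ℝ) T, ContDiff ℝ 2 (h t)
  reg_phi : ∀ t ∈ Icc (0:ℝ) T, ContDiff ℝ 2 (φp t)
  reg_t_rho : ∀ t ∈ Icc (0:ℝ) T, ∀ x : T2, DifferentiableAt ℝ (fun s => ρ s x) t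
  reg_t_v : ∀ t ∈ Icc (0:ℝ) T, ∀ x : T2,
    DifferentiableAt ℝ (fun s => (grad2 (h s) x).1) t ∧
    DifferentiableAt ℝ (fun s => (grad2 (h s) x).2) t
  cont_eq : ∀ t ∈ Icc (0:ℝ) T, ∀ x : T2,
    deriv (fun s => ρ s x) t + div2 (fun y => (1 + ρ t y) • grad2 (h t) y) x = 0
  mom_eq1 : ∀ t ∈ Icc (0:ℝ) T, ∀ x : T2,
    deriv (fun s => (grad2 (h s) x).1) t
      + (grad2 (h t) x).1 * d1 (fun y => (grad2 (h t) y).1) x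
      + (grad2 (h t) x).2 * d2 (fun y => (grad2 (h t) y).1) x
      + d1 (ρ t) x = d1 (φp t) x
  mom_eq2 : ∀ t ∈ Icc (0:ℝ) T, ∀ x : T2,
    deriv (fun s => (grad2 (h s) x).2) t
      + (grad2 (h t) x).1 * d1 (fun y => (grad2 (h t) y).2) x
      + (grad2 (h t) x).2 * d2 (fun y => (grad2 (h t) y).2) x
      + d2 (ρ t) x = d2 (φp t) x
  poisson_eq : ∀ t ∈ Icc (0:ℝ) T, ∀ x : T2, lap2 (φp t) x = ρ t x
  neutral : ∀ t ∈ Icc (0:ℝ) T, (∫ x in box R, ρ t x) = 0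
  zero_mom : ∀ t ∈ Icc (0:ℝ) T, (∫ x in box R, grad2 (h t) x) = (0 : T2)

/-- `U ∈ C([0,T], H^s)`: finiteness of the `H^s` norm and continuity in the `H^s` metric. -/
def ContHN (R : ℝ) (s T : ℝ) (U : ℝ → T2 → ℂ) : Prop :=
  (∀ t ∈ Icc (0:ℝ) T, HNe R s (U t) < ⊤) ∧
  (∀ t ∈ Icc (0:ℝ) T, ∀ ε : ℝ, 0 < ε → ∃ δ : ℝ, 0 < δ ∧ ∀ t' ∈ Icc (0:ℝ) T,
    |t' - t| < δ → HNe R s (fun x => U t' x - U t x) < ENNReal.ofReal ε)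

/-- `U ∈ C¹([0,T], H^s)`: differentiability in the `H^s` metric with continuous derivative. -/
def C1HN (R : ℝ) (s T : ℝ) (U : ℝ → T2 → ℂ) : Prop :=
  ∃ U' : ℝ → T2 → ℂ, ContHN R s T U' ∧
    ∀ t ∈ Icc (0:ℝ) T, ∀ ε : ℝ, 0 < ε → ∃ δ : ℝ, 0 < δ ∧ ∀ t' ∈ Icc (0:ℝ) T,
      t' ≠ t → |t' - t| < δ →
      HNe R s (fun x => (((t' - t : ℝ) : ℂ))⁻¹ * (U t' x - U t x) - U' t x)
        < ENNReal.ofReal ε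

/-- H^s norm of a vector field (sum over the two components). -/
def HNev (R : ℝ) (s : ℝ) (v : T2 → T2) : ℝ≥0∞ :=
  HNe R s (cf (fun x => (v x).1)) + HNe R s (cf (fun x => (v x).2))

/-- A smooth radial-type cutoff: 1 on B(0,2/3), 0 outside B(0,3/2), values in [0,1]. -/
def IsCutoff (φ : T2 → ℝ) : Prop :=
  ContDiff ℝ (⊤ : ℕ∞) φ ∧ (∀ x : T2, φ x ∈ Icc (0:ℝ) 1) ∧
  (∀ x : T2, en x ≤ 2/3 → φ x = 1) ∧ (∀ x : T2, (3:ℝ)/2 ≤ en x → φ x = 0)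

/-- φ_k(ξ) = φ(ξ/2^k) − φ(ξ/2^{k-1}). -/
def phiK (φ : T2 → ℝ) (k : ℤ) (ξ : T2) : ℝ :=
  φ ((2:ℝ) ^ (-k) • ξ) - φ ((2:ℝ) ^ (-(k-1)) • ξ)

/-- Littlewood–Paley projection P_k. -/
def PK (R : ℝ) (φ : T2 → ℝ) (k : ℤ) (u : T2 → ℂ) : T2 → ℂ :=
  op R (fun ξ => ((phiK φ k ξ : ℝ) : ℂ)) u

/-- P_{[a,b]} = Σ_{a ≤ k ≤ b} P_k. -/
def PKband (R : ℝ) (φ : T2 → ℝ) (a b : ℤ) (u : T2 → ℂ) : T2 → ℂ := fun x =>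
  ∑ j ∈ Finset.Icc a b, PK R φ j u x

/-- P_{≥0} = Σ_{k ≥ 0} P_k, i.e. the multiplier 1 − φ_{≤ -1}(ξ) = 1 − φ(2ξ). -/
def Pge0 (R : ℝ) (φ : T2 → ℝ) (u : T2 → ℂ) : T2 → ℂ :=
  op R (fun ξ => (((1 : ℝ) - φ ((2:ℝ) • ξ) : ℝ) : ℂ)) u

/-- k⁺ = max(k, 0). -/
def kplus (k : ℤ) : ℤ := max k 0

/-- The X norm: Σ_k 2^{Mk⁺} ‖P_k u‖_{L^∞}. -/
def XnormE (R : ℝ) (φ : T2 → ℝ) (M : ℕ) (u : T2 → ℂ) : ℝ≥0∞ :=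
  ∑' k : ℤ, ENNReal.ofReal ((2:ℝ) ^ ((M : ℤ) * kplus k)) * LpE R ⊤ (PK R φ k u)

/-- ‖x‖ = dist(x, (Rℤ)²). -/
def torusDist (R : ℝ) (x : T2) : ℝ := ⨅ k : ℤ × ℤ, en (x - lat R k)

/-- The Z norm: ‖(1+‖x‖)^{2/3} Λ^{M+2} u‖_{L²}. -/
def ZnormE (R : ℝ) (M : ℕ) (u : T2 → ℂ) : ℝ≥0∞ :=
  LpE R 2 (fun x => (((1 + torusDist R x) ^ ((2:ℝ)/3) : ℝ) : ℂ) * lamPow R ((M:ℝ) + 2) u x)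

def ZnormEv (R : ℝ) (M : ℕ) (v : T2 → T2) : ℝ≥0∞ :=
  ZnormE R M (cf (fun x => (v x).1)) + ZnormE R M (cf (fun x => (v x).2))

/-- ‖U‖_{L²([0,t]) X}. -/
def L2X (R : ℝ) (φ : T2 → ℝ) (M : ℕ) (t : ℝ) (U : ℝ → T2 → ℂ) : ℝ≥0∞ :=
  (∫⁻ s in Icc (0:ℝ) t, (XnormE R φ M (U s)) ^ 2) ^ ((1:ℝ)/2)

/-- Fourier coefficient in x of a symbol a(x,ζ). -/
def symCoeff (R : ℝ) (a : T2 → T2 → ℂ) (k : ℤ × ℤ) (ζ : T2) : ℂ :=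
  ∫ x in box R, a x ζ * Complex.exp (-Complex.I * ((dot2 x (freq R k) : ℝ) : ℂ))

/-- φ_{≤-10}(|ξ−η|/|ξ+η|), taken to be 0 when ξ+η = 0. -/
def cutRatio (φ : T2 → ℝ) (ξ η : T2) : ℝ :=
  if ξ + η = (0 : T2) then 0
  else φ ((((2:ℝ) ^ (10 : ℕ) * en (ξ - η) / en (ξ + η) : ℝ), (0:ℝ)) : T2)

/-- The (Weyl-quantized) paradifferential operator T_a. -/
def Ta (R : ℝ) (φ : T2 → ℝ) (a : T2 → T2 → ℂ) (f : T2 → ℂ) : T2 → ℂ := fun x =>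
  (1 / (R : ℂ) ^ 2) * ∑' ξi : ℤ × ℤ,
    ((1 / (R : ℂ) ^ 2) * ∑' ηi : ℤ × ℤ,
      ((cutRatio φ (freq R ξi) (freq R ηi) : ℝ) : ℂ) *
        symCoeff R a (ξi - ηi) ((2:ℝ)⁻¹ • (freq R ξi + freq R ηi)) * fCoeff R f ηi) *
    Complex.exp (Complex.I * ((dot2 x (freq R ξi) : ℝ) : ℂ))

/-- |a|(x,ζ) = Σ_{|I| ≤ 8} |ζ|^{|I|} |∂^I_ζ a(x,ζ)|. -/
def symAbs (a : T2 → T2 → ℂ) (x ζ : T2) : ℝ :=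
  ∑ n ∈ Finset.range 9, en ζ ^ n * ‖iteratedFDeriv ℝ n (a x) ζ‖

/-- ‖a‖_{𝓛^q_m} ≤ A, stated as: ‖ |a|(·,ζ) ‖_{L^q} ≤ A (1+|ζ|)^m for all ζ ≠ 0. -/
def SymLe (R : ℝ) (m : ℝ) (q : ℝ≥0∞) (a : T2 → T2 → ℂ) (A : ℝ) : Prop :=
  ∀ ζ : T2, ζ ≠ 0 →
    eLpNorm (fun x => symAbs a x ζ) q (μbox R) ≤ ENNReal.ofReal (A * (1 + en ζ) ^ m)

def symAbsDx (a : T2 → T2 → ℂ) (x ζ : T2) : ℝ :=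
  ∑ n ∈ Finset.range 9,
    en ζ ^ n * ‖iteratedFDeriv ℝ n (fun ζ' => fderiv ℝ (fun x' => a x' ζ') x) ζ‖

/-- ‖∇_x a‖_{𝓛^q_m} ≤ A. -/
def SymDxLe (R : ℝ) (m : ℝ) (q : ℝ≥0∞) (a : T2 → T2 → ℂ) (A : ℝ) : Prop :=
  ∀ ζ : T2, ζ ≠ 0 →
    eLpNorm (fun x => symAbsDx a x ζ) q (μbox R) ≤ ENNReal.ofReal (A * (1 + en ζ) ^ m)

/-- T_f for a symbol f(x) independent of ζ. -/
def TaF (R : ℝ) (φ : T2 → ℝ) (f g : T2 → ℂ) : T2 → ℂ := Ta R φ (fun x _ => f x) g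

/-- H(f,g) = fg − T_f g − T_g f. -/
def Hbil (R : ℝ) (φ : T2 → ℝ) (f g : T2 → ℂ) : T2 → ℂ := fun x =>
  f x * g x - TaF R φ f g x - TaF R φ g f x

/-- E(a,b) = T_a T_b − T_{ab}. -/
def E2 (R : ℝ) (φ : T2 → ℝ) (a b : T2 → T2 → ℂ) (f : T2 → ℂ) : T2 → ℂ := fun x =>
  Ta R φ a (Ta R φ b f) x - Ta R φ (fun y ζ => a y ζ * b y ζ) f x

/-- E(a,b,c) = T_a T_b T_c − T_{abc}. -/
def E3 (R : ℝ) (φ : T2 → ℝ) (a b c : T2 → T2 → ℂ) (f : T2 → ℂ) : T2 → ℂ := fun x =>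
  Ta R φ a (Ta R φ b (Ta R φ c f)) x - Ta R φ (fun y ζ => a y ζ * b y ζ * c y ζ) f x

/-- T_{a_1} ⋯ T_{a_n}. -/
def TaChain (R : ℝ) (φ : T2 → ℝ) : {n : ℕ} → (Fin n → T2 → T2 → ℂ) → (T2 → ℂ) → (T2 → ℂ)
  | 0, _, f => f
  | _ + 1, a, f => Ta R φ (a 0) (TaChain R φ (fun j => a j.succ) f)

/-- E(a_1,…,a_n) = T_{a_1}⋯T_{a_n} − T_{a_1⋯a_n}. -/
def EnOp (R : ℝ) (φ : T2 → ℝ) {n : ℕ} (a : Fin n → T2 → T2 → ℂ) (f : T2 → ℂ) : T2 → ℂ :=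
  fun x => TaChain R φ a f x - Ta R φ (fun y ζ => ∏ j, a j y ζ) f x

/-- Real part of the L² inner product on the torus. -/
def ipRe (R : ℝ) (f g : T2 → ℂ) : ℝ := (∫ x in box R, f x * (starRingEnd ℂ) (g x)).re

/-- The phase Φ_{μν}(ξ₁,ξ₂) = Λ(ξ₁+ξ₂) − μΛ(ξ₁) − νΛ(ξ₂), for signs μ, ν ∈ {1,-1}. -/
def Phi (μ ν : ℝ) (ξ₁ ξ₂ : T2) : ℝ := lam (ξ₁ + ξ₂) - μ * lam ξ₁ - ν * lam ξ₂

def mA (ξ₁ ξ₂ : T2) : ℂ := ((lam (ξ₁ + ξ₂) * en ξ₁ / lam ξ₁ : ℝ) : ℂ)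
def mB (ξ₁ ξ₂ : T2) : ℂ := ((lam (ξ₁ + ξ₂) * en ξ₂ / lam ξ₂ : ℝ) : ℂ)
def mC (ξ₁ ξ₂ : T2) : ℂ := ((en (ξ₁ + ξ₂) : ℝ) : ℂ)

/-- The basic quadratic multipliers of the Euler–Poisson nonlinearity. -/
def IsBasicM (m : T2 → T2 → ℂ) : Prop := m = mA ∨ m = mB ∨ m = mC

/-- f_+ = f, f_- = conj f (for a sign μ ∈ {1,-1}). -/
def sgnFun (μ : ℝ) (f : T2 → ℂ) : T2 → ℂ :=
  if μ = 1 then f else fun x => (starRingEnd ℂ) (f x)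

/-- v_j, the j-th component of v = ∇h. -/
def vcomp (h : T2 → ℝ) (j : Fin 2) : T2 → ℝ := fun x => if j = 0 then d1 h x else d2 h x

/-- The semilinear quadratic term 𝓢 = −ΛR_j H(ρ, v_j) − (i/2)|∇|H(v_j, v_j). -/
def calS (R : ℝ) (φ : T2 → ℝ) (ρ h : T2 → ℝ) : T2 → ℂ := fun x =>
  -(∑ j : Fin 2, op R
      (fun ξ => ((lam ξ : ℝ) : ℂ) *
        (Complex.I * (((if j = (0 : Fin 2) then ξ.1 else ξ.2) : ℝ) : ℂ) * (((en ξ)⁻¹ : ℝ) : ℂ)))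
      (Hbil R φ (cf ρ) (cf (vcomp h j))) x)
  - (Complex.I / 2) * ∑ j : Fin 2, absGrad R (Hbil R φ (cf (vcomp h j)) (cf (vcomp h j))) x

/-- 𝓤 = X + i T_{√(1+ρ)} Y. -/
def calU (R : ℝ) (φ : T2 → ℝ) (ρ h : T2 → ℝ) : T2 → ℂ := fun x =>
  LamInvGrad R (cf ρ) x +
    Complex.I * Ta R φ (fun y _ => ((Real.sqrt (1 + ρ y) : ℝ) : ℂ)) (absGrad R (cf h)) x

def sqrtSym (ρ : T2 → ℝ) : T2 → T2 → ℂ := fun y _ => ((Real.sqrt (1 + ρ y) : ℝ) : ℂ)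
def sqrtm1Sym (ρ : T2 → ℝ) : T2 → T2 → ℂ := fun y _ => ((Real.sqrt (1 + ρ y) - 1 : ℝ) : ℂ)
def vdotSym (h : T2 → ℝ) : T2 → T2 → ℂ := fun y ζ => ((dot2 (grad2 h y) ζ : ℝ) : ℂ)
def lamSym2 : T2 → T2 → ℂ := fun _ ζ => ((lam ζ : ℝ) : ℂ)
def enSym2 : T2 → T2 → ℂ := fun _ ζ => ((en ζ : ℝ) : ℂ)
def zetaOverEn (j : Fin 2) : T2 → T2 → ℂ :=
  fun _ ζ => (((if j = (0 : Fin 2) then ζ.1 else ζ.2) * (en ζ)⁻¹ : ℝ) : ℂ)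
def lamZetaOverEn (j : Fin 2) : T2 → T2 → ℂ :=
  fun _ ζ => ((lam ζ * (if j = (0 : Fin 2) then ζ.1 else ζ.2) * (en ζ)⁻¹ : ℝ) : ℂ)
def enOverLam : T2 → T2 → ℂ := fun _ ζ => ((en ζ * (lam ζ)⁻¹ : ℝ) : ℂ)
def rhoSym (ρ : T2 → ℝ) : T2 → T2 → ℂ := fun y _ => ((ρ y : ℝ) : ℂ)
def vjSym (h : T2 → ℝ) (j : Fin 2) : T2 → T2 → ℂ := fun y _ => ((vcomp h j y : ℝ) : ℂ)

/-- Exponential sums along an arithmetic progression of step `R`. -/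
lemma summable_exp_neg_abs_progression {R c : ℝ} (hR : 0 < R) (hc : 0 < c) (x : ℝ) :
    Summable (fun n : ℤ => exp (-(c * |x + R * n|))) ∧
      ∑' n : ℤ, exp (-(c * |x + R * n|)) ≤ 2 * (1 + 1 / (c * R)) := by
  have hcR : 0 < c * R := mul_pos hc hR
  have hr : exp (-(c * R)) < 1 := by simpa using hcR
  have hgeo := summable_geometric_of_lt_one (exp_pos (-(c * R))).le hr
  have hgt := tsum_geometric_of_lt_one (exp_pos (-(c * R))).le hr
  have hbd : (1 - exp (-(c * R)))⁻¹ ≤ 1 + 1 / (c * R) := by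
    have h1 := add_one_le_exp (c * R)
    have h2 : exp (-(c * R)) ≤ (1 + c * R)⁻¹ := by
      rw [exp_neg]
      exact inv_anti₀ (by positivity) (by linarith)
    have h3 : c * R / (1 + c * R) ≤ 1 - exp (-(c * R)) := by
      have : c * R / (1 + c * R) = 1 - (1 + c * R)⁻¹ := by field_simp; ring
      linarith
    calc (1 - exp (-(c * R)))⁻¹ ≤ (c * R / (1 + c * R))⁻¹ := inv_anti₀ (by positivity) h3
      _ = 1 + 1 / (c * R) := by field_simp; ring
  set F : ℤ → ℝ := fun n => exp (-(c * |R * Int.fract (x / R) + R * n|)) with hF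
  have hf0 := Int.fract_nonneg (x / R)
  have hf1 := Int.fract_lt_one (x / R)
  have hpow : ∀ m : ℕ, exp (-(c * R)) ^ m = exp (-(c * (R * m))) := by
    intro m; rw [← exp_nat_mul]; congr 1; ring
  have hA : ∀ m : ℕ, F (m : ℤ) ≤ exp (-(c * R)) ^ m := by
    intro m
    rw [hpow, hF]
    apply exp_le_exp.2
    apply neg_le_neg
    apply mul_le_mul_of_nonneg_left _ hc.le
    refine le_trans ?_ (le_abs_self _)
    push_cast
    nlinarith [mul_nonneg hR.le hf0]
  have hB : ∀ m : ℕ, F (-((m : ℤ) + 1)) ≤ exp (-(c * R)) ^ m := by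
    intro m
    rw [hpow, hF]
    apply exp_le_exp.2
    apply neg_le_neg
    apply mul_le_mul_of_nonneg_left _ hc.le
    refine le_trans ?_ (neg_le_abs _)
    push_cast
    nlinarith [mul_nonneg hR.le (sub_nonneg.2 hf1.le)]
  have hsA : Summable (fun m : ℕ => F (m : ℤ)) :=
    Summable.of_nonneg_of_le (fun m => (exp_pos _).le) hA hgeo
  have hsB : Summable (fun m : ℕ => F (-((m : ℤ) + 1))) :=
    Summable.of_nonneg_of_le (fun m => (exp_pos _).le) hB hgeo
  have hsF : Summable F := Summable.of_nat_of_neg_add_one hsA hsB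
  have htF : ∑' n, F n ≤ 2 * (1 + 1 / (c * R)) := by
    rw [tsum_of_nat_of_neg_add_one hsA hsB]
    have e1 := hsA.tsum_le_tsum hA hgeo
    have e2 := hsB.tsum_le_tsum hB hgeo
    rw [hgt] at e1 e2
    linarith
  have heq : (fun n : ℤ => exp (-(c * |x + R * n|))) = F ∘ (Equiv.addRight ⌊x / R⌋) := by
    funext n
    simp only [hF, Function.comp, Equiv.coe_addRight]
    have : x = R * (Int.fract (x / R) + ⌊x / R⌋) := by
      rw [Int.fract_add_floor]; field_simp
    congr 4
    conv_lhs => rw [this]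
    push_cast; ring
  refine ⟨by rw [heq]; exact (Equiv.summable_iff _).2 hsF, ?_⟩
  rw [heq]
  exact ((Equiv.addRight ⌊x / R⌋).tsum_eq F).trans_le htF

/-- Exponential sums over a planar lattice. -/
lemma summable_exp_neg_abs_lattice {R c : ℝ} (hR : 0 < R) (hc : 0 < c) (x : T2) :
    Summable (fun n : ℤ × ℤ => exp (-(c * (|x.1 + R * n.1| + |x.2 + R * n.2|)))) ∧
      ∑' n : ℤ × ℤ, exp (-(c * (|x.1 + R * n.1| + |x.2 + R * n.2|)))
        ≤ (2 * (1 + 1 / (c * R))) ^ 2 := by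
  obtain ⟨s1, t1⟩ := summable_exp_neg_abs_progression hR hc x.1
  obtain ⟨s2, t2⟩ := summable_exp_neg_abs_progression hR hc x.2
  have heq : (fun n : ℤ × ℤ => exp (-(c * (|x.1 + R * n.1| + |x.2 + R * n.2|)))) =
      fun n : ℤ × ℤ => exp (-(c * |x.1 + R * n.1|)) * exp (-(c * |x.2 + R * n.2|)) := by
    funext n; rw [← exp_add]; congr 1; ring
  have hs := s1.mul_of_nonneg s2 (fun _ => (exp_pos _).le) (fun _ => (exp_pos _).le)
  rw [heq]
  refine ⟨hs, ?_⟩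
  rw [← s1.tsum_mul_tsum s2 hs, sq]
  exact mul_le_mul t1 t2 (tsum_nonneg fun _ => (exp_pos _).le) (by positivity)

/-- Fundamental theorem of calculus on `(0, ∞)` for a nonnegative derivative, with limits at both
ends. -/
lemma integral_Ioi_zero_of_hasDerivAt_of_nonneg {g g' : ℝ → ℝ} {l m : ℝ}
    (hd : ∀ x ∈ Ioi (0 : ℝ), HasDerivAt g (g' x) x) (hn : ∀ x ∈ Ioi (0 : ℝ), 0 ≤ g' x)
    (h0 : Filter.Tendsto g (nhdsWithin 0 (Ioi 0)) (nhds m))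
    (hl : Filter.Tendsto g Filter.atTop (nhds l)) :
    IntegrableOn g' (Ioi 0) ∧ ∫ x in Ioi (0 : ℝ), g' x = l - m := by
  classical
  set G := Function.update g 0 m with hG
  have hGe : ∀ x ∈ Ioi (0 : ℝ), G =ᶠ[nhds x] g := by
    intro x hx
    filter_upwards [isOpen_Ioi.mem_nhds hx] with y hy
    exact Function.update_of_ne (ne_of_gt hy) _ _
  have hd' : ∀ x ∈ Ioi (0 : ℝ), HasDerivAt G (g' x) x := fun x hx =>
    (hd x hx).congr_of_eventuallyEq (hGe x hx)
  have hc : ContinuousWithinAt G (Ici 0) 0 := by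
    rw [hG, continuousWithinAt_update_same]
    simpa using h0
  have hl' : Filter.Tendsto G Filter.atTop (nhds l) := by
    refine hl.congr' ?_
    filter_upwards [Filter.eventually_gt_atTop (0 : ℝ)] with y hy
    exact (Function.update_of_ne (ne_of_gt hy) _ _).symm
  refine ⟨integrableOn_Ioi_deriv_of_nonneg hc hd' hn hl', ?_⟩
  rw [integral_Ioi_of_hasDerivAt_of_nonneg hc hd' hn hl', hG, Function.update_self]

/-- The primitive of the Gaussian vanishing at the origin. -/
def gaussPrim (x : ℝ) : ℝ := ∫ u in (0 : ℝ)..x, exp (-u ^ 2)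

lemma hasDerivAt_gaussPrim (x : ℝ) : HasDerivAt gaussPrim (exp (-x ^ 2)) x := by
  have hc : Continuous fun u : ℝ => exp (-u ^ 2) := by fun_prop
  exact intervalIntegral.integral_hasDerivAt_right (hc.intervalIntegrable _ _)
    (hc.stronglyMeasurableAtFilter _ _) hc.continuousAt

lemma tendsto_gaussPrim_atTop :
    Filter.Tendsto gaussPrim Filter.atTop (nhds (√π / 2)) := by
  have h1 : IntegrableOn (fun u : ℝ => exp (-u ^ 2)) (Ioi 0) := by
    have := (integrable_exp_neg_mul_sq (b := 1) one_pos).integrableOn (s := Ioi (0 : ℝ))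
    simpa using this
  have h2 := intervalIntegral_tendsto_integral_Ioi 0 h1 Filter.tendsto_id
  have h3 := integral_gaussian_Ioi 1
  simp only [neg_mul, one_mul, div_one] at h3
  rwa [h3] at h2

lemma gaussPrim_neg (x : ℝ) : gaussPrim (-x) = -gaussPrim x := by
  have := intervalIntegral.integral_comp_neg (a := 0) (b := x) (fun u : ℝ => exp (-u ^ 2))
  simp only [neg_sq, neg_zero] at this
  rw [gaussPrim, gaussPrim, this, intervalIntegral.integral_symm]

lemma tendsto_gaussPrim_atBot :
    Filter.Tendsto gaussPrim Filter.atBot (nhds (-(√π / 2))) := by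
  have := (tendsto_gaussPrim_atTop.comp Filter.tendsto_neg_atBot_atTop).neg
  refine this.congr fun x => ?_
  simp [gaussPrim_neg]

lemma integral_exp_neg_sq_add_inv_sq {A B : ℝ} (hA : 0 < A) (hB : 0 < B) :
    (IntegrableOn (fun v : ℝ => exp (-(A ^ 2 * v ^ 2 + B ^ 2 / v ^ 2))) (Ioi 0) ∧
      ∫ v in Ioi (0 : ℝ), exp (-(A ^ 2 * v ^ 2 + B ^ 2 / v ^ 2))
        = √π / (2 * A) * exp (-(2 * A * B))) ∧
    (IntegrableOn (fun v : ℝ => (v ^ 2)⁻¹ * exp (-(A ^ 2 * v ^ 2 + B ^ 2 / v ^ 2))) (Ioi 0) ∧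
      ∫ v in Ioi (0 : ℝ), (v ^ 2)⁻¹ * exp (-(A ^ 2 * v ^ 2 + B ^ 2 / v ^ 2))
        = √π / (2 * B) * exp (-(2 * A * B))) := by
  have hp : ∀ v ∈ Ioi (0 : ℝ), HasDerivAt (fun v => exp (2 * A * B) * gaussPrim (A * v + B / v))
      ((A - B / v ^ 2) * exp (-(A ^ 2 * v ^ 2 + B ^ 2 / v ^ 2))) v := by
    intro v hv
    have hv0 : v ≠ 0 := ne_of_gt hv
    have h1 : HasDerivAt (fun v => A * v + B / v) (A - B / v ^ 2) v := by
      have := ((hasDerivAt_id v).const_mul A).add ((hasDerivAt_inv hv0).const_mul B)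
      refine (this.congr_deriv ?_)
      ring
    have h2 := ((hasDerivAt_gaussPrim _).comp v h1).const_mul (exp (2 * A * B))
    refine h2.congr_deriv ?_
    rw [mul_comm (exp (-_)), mul_left_comm, ← exp_add]
    congr 2
    field_simp
    ring
  have hm : ∀ v ∈ Ioi (0 : ℝ), HasDerivAt (fun v => exp (-(2 * A * B)) * gaussPrim (A * v - B / v))
      ((A + B / v ^ 2) * exp (-(A ^ 2 * v ^ 2 + B ^ 2 / v ^ 2))) v := by
    intro v hv
    have hv0 : v ≠ 0 := ne_of_gt hv
    have h1 : HasDerivAt (fun v => A * v - B / v) (A + B / v ^ 2) v := by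
      have := ((hasDerivAt_id v).const_mul A).sub ((hasDerivAt_inv hv0).const_mul B)
      refine (this.congr_deriv ?_)
      ring
    have h2 := ((hasDerivAt_gaussPrim _).comp v h1).const_mul (exp (-(2 * A * B)))
    refine h2.congr_deriv ?_
    rw [mul_comm (exp (-_ ^ 2)), mul_left_comm, ← exp_add]
    congr 2
    field_simp
    ring
  have hAv : Filter.Tendsto (fun v : ℝ => A * v) Filter.atTop Filter.atTop :=
    Filter.tendsto_id.const_mul_atTop hA
  have hBv : Filter.Tendsto (fun v : ℝ => B / v) Filter.atTop (nhds 0) :=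
    tendsto_const_nhds.div_atTop Filter.tendsto_id
  have hAv0 : Filter.Tendsto (fun v : ℝ => A * v) (nhdsWithin 0 (Ioi 0)) (nhds 0) := by
    have : Continuous fun v : ℝ => A * v := by fun_prop
    simpa using (this.tendsto 0).mono_left nhdsWithin_le_nhds
  have hBv0 : Filter.Tendsto (fun v : ℝ => B / v) (nhdsWithin 0 (Ioi 0)) Filter.atTop := by
    simpa [div_eq_mul_inv] using tendsto_inv_nhdsGT_zero.const_mul_atTop hB
  have p_top := (tendsto_gaussPrim_atTop.comp (hAv.atTop_add hBv)).const_mul (exp (2 * A * B))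
  have p_zero := (tendsto_gaussPrim_atTop.comp (hAv0.add_atTop hBv0)).const_mul (exp (2 * A * B))
  have m_top := (tendsto_gaussPrim_atTop.comp
    (hAv.atTop_add hBv.neg)).const_mul (exp (-(2 * A * B)))
  have m_zero := (tendsto_gaussPrim_atBot.comp
    (hAv0.add_atBot (Filter.tendsto_neg_atTop_atBot.comp hBv0))).const_mul (exp (-(2 * A * B)))
  have m_top' : Filter.Tendsto (fun v => exp (-(2 * A * B)) * gaussPrim (A * v - B / v))
      Filter.atTop (nhds (exp (-(2 * A * B)) * (√π / 2))) := m_top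
  have m_zero' : Filter.Tendsto (fun v => exp (-(2 * A * B)) * gaussPrim (A * v - B / v))
      (nhdsWithin 0 (Ioi 0)) (nhds (exp (-(2 * A * B)) * (-(√π / 2)))) := m_zero
  constructor
  · obtain ⟨hi, he⟩ := integral_Ioi_zero_of_hasDerivAt_of_nonneg
      (fun v hv => (((hp v hv).add (hm v hv)).const_mul (1 / (2 * A))).congr_deriv
        (show _ = exp (-(A ^ 2 * v ^ 2 + B ^ 2 / v ^ 2)) by field_simp; ring))
      (fun v _ => (exp_pos _).le)
      ((p_zero.add m_zero').const_mul (1 / (2 * A)))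
      ((p_top.add m_top').const_mul (1 / (2 * A)))
    refine ⟨hi, he.trans ?_⟩
    field_simp
    ring
  · obtain ⟨hi, he⟩ := integral_Ioi_zero_of_hasDerivAt_of_nonneg
      (fun v hv => (((hm v hv).sub (hp v hv)).const_mul (1 / (2 * B))).congr_deriv
        (show _ = (v ^ 2)⁻¹ * exp (-(A ^ 2 * v ^ 2 + B ^ 2 / v ^ 2)) by
          have : v ≠ 0 := ne_of_gt hv
          field_simp; ring))
      (fun v _ => mul_nonneg (by positivity) (exp_pos _).le)
      ((m_zero'.sub p_zero).const_mul (1 / (2 * B)))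
      ((m_top'.sub p_top).const_mul (1 / (2 * B)))
    refine ⟨hi, he.trans ?_⟩
    field_simp
    ring

lemma dot2_self_nonneg (z : T2) : 0 ≤ dot2 z z :=
  add_nonneg (mul_self_nonneg _) (mul_self_nonneg _)

lemma en_sq (z : T2) : en z ^ 2 = dot2 z z := Real.sq_sqrt (dot2_self_nonneg z)

lemma en_nonneg (z : T2) : 0 ≤ en z := Real.sqrt_nonneg _

lemma lam_sq (z : T2) : lam z ^ 2 = 1 + dot2 z z :=
  Real.sq_sqrt (by linarith [dot2_self_nonneg z])

lemma one_le_lam (z : T2) : 1 ≤ lam z :=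
  Real.one_le_sqrt.2 (by linarith [dot2_self_nonneg z])

lemma lam_pos (z : T2) : 0 < lam z := one_pos.trans_le (one_le_lam z)

lemma en_le_lam (z : T2) : en z ≤ lam z := Real.sqrt_le_sqrt (by linarith)

lemma half_abs_add_abs_le_en (z : T2) : 1 / 2 * (|z.1| + |z.2|) ≤ en z := by
  have h1 : |z.1| ≤ en z := Real.abs_le_sqrt (by unfold dot2; nlinarith [sq_nonneg z.2])
  have h2 : |z.2| ≤ en z := Real.abs_le_sqrt (by unfold dot2; nlinarith [sq_nonneg z.1])
  linarith

lemma summable_exp_neg_en_lat {R c : ℝ} (hR : 0 < R) (hc : 0 < c) (x : T2) :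
    Summable (fun m : ℤ × ℤ => exp (-(c * en (x + lat R m)))) ∧
      ∑' m : ℤ × ℤ, exp (-(c * en (x + lat R m))) ≤ (2 * (1 + 2 / (c * R))) ^ 2 := by
  obtain ⟨hs, ht⟩ := summable_exp_neg_abs_lattice hR (half_pos hc) x
  have hle : ∀ m : ℤ × ℤ, exp (-(c * en (x + lat R m))) ≤
      exp (-(c / 2 * (|x.1 + R * m.1| + |x.2 + R * m.2|))) := by
    intro m
    apply exp_le_exp.2
    have := half_abs_add_abs_le_en (x + lat R m)
    simp only [lat, Prod.fst_add, Prod.snd_add] at this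
    unfold lat
    nlinarith
  have hs' := Summable.of_nonneg_of_le (fun _ => (exp_pos _).le) hle hs
  refine ⟨hs', (hs'.tsum_le_tsum hle hs).trans (ht.trans (le_of_eq ?_))⟩
  field_simp

lemma summable_exp_neg_lam {R τ : ℝ} (hR : 0 < R) (hτ : 0 < τ) :
    Summable (fun n : ℤ × ℤ => exp (-(τ * lam (freq R n)))) ∧
      ∑' n : ℤ × ℤ, exp (-(τ * lam (freq R n))) ≤ (2 * (1 + R / (π * τ))) ^ 2 := by
  have hR' : 0 < 2 * π / R := by positivity
  obtain ⟨hs, ht⟩ := summable_exp_neg_en_lat hR' hτ 0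
  have hle : ∀ n : ℤ × ℤ, exp (-(τ * lam (freq R n))) ≤
      exp (-(τ * en (0 + lat (2 * π / R) n))) := by
    intro n
    have : freq R n = 0 + lat (2 * π / R) n := by
      rw [zero_add]; unfold freq lat; ext <;> simp <;> ring
    rw [← this]
    exact exp_le_exp.2 (neg_le_neg (mul_le_mul_of_nonneg_left (en_le_lam _) hτ.le))
  have hs' := Summable.of_nonneg_of_le (fun _ => (exp_pos _).le) hle hs
  refine ⟨hs', (hs'.tsum_le_tsum hle hs).trans (ht.trans (le_of_eq ?_))⟩
  field_simp

lemma summable_exp_neg_sq {c : ℝ} (hc : 0 < c) : Summable (fun n : ℤ => exp (-(c * (n : ℝ) ^ 2))) :=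
    by
  obtain ⟨hs, -⟩ := summable_exp_neg_abs_progression one_pos hc 0
  refine Summable.of_nonneg_of_le (fun _ => (exp_pos _).le) (fun n => ?_) hs
  apply exp_le_exp.2
  apply neg_le_neg
  apply mul_le_mul_of_nonneg_left _ hc.le
  rw [zero_add, one_mul, ← sq_abs (n : ℝ)]
  rcases eq_or_ne n 0 with rfl | hn
  · simp
  · have : (1 : ℝ) ≤ |(n : ℝ)| := by exact_mod_cast Int.one_le_abs hn
    nlinarith

/-- Poisson summation for the Gaussian on a circle of length `R`. -/
lemma tsum_gauss_circle {R s : ℝ} (hR : 0 < R) (hs : 0 < s) (x : ℝ) :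
    ∑' n : ℤ, ((exp (-(s * (2 * π * n / R) ^ 2)) : ℝ) : ℂ) *
        Complex.exp (Complex.I * ((x * (2 * π * n / R) : ℝ) : ℂ)) =
      ((∑' m : ℤ, R / √(4 * π * s) * exp (-((x + R * m) ^ 2 / (4 * s))) : ℝ) : ℂ) := by
  have ha : 0 < ((4 * π * s / R ^ 2 : ℝ) : ℂ).re := by
    rw [Complex.ofReal_re]; positivity
  have h := Complex.tsum_exp_neg_quadratic ha (Complex.I * ((x / R : ℝ) : ℂ))
  have hRc : (R : ℂ) ≠ 0 := by exact_mod_cast hR.ne'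
  have hsc : (s : ℂ) ≠ 0 := by exact_mod_cast hs.ne'
  have hpc : (π : ℂ) ≠ 0 := by exact_mod_cast pi_ne_zero
  have hL : ∀ n : ℤ, ((exp (-(s * (2 * π * n / R) ^ 2)) : ℝ) : ℂ) *
      Complex.exp (Complex.I * ((x * (2 * π * n / R) : ℝ) : ℂ)) =
      Complex.exp (-π * ((4 * π * s / R ^ 2 : ℝ) : ℂ) * (n : ℂ) ^ 2 +
        2 * π * (Complex.I * ((x / R : ℝ) : ℂ)) * n) := by
    intro n
    rw [Complex.ofReal_exp, ← Complex.exp_add]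
    congr 1
    push_cast
    field_simp
    ring
  simp_rw [hL]
  rw [h, Complex.ofReal_tsum, ← tsum_mul_left, ← (Equiv.neg ℤ).tsum_eq]
  refine tsum_congr fun n => ?_
  rw [Complex.ofReal_mul, Complex.ofReal_exp]
  congr 1
  · have hsq : √(4 * π * s / R ^ 2) = √(4 * π * s) / R := by
      rw [Real.sqrt_div (by positivity), Real.sqrt_sq hR.le]
    rw [show (1 / 2 : ℂ) = ((1 / 2 : ℝ) : ℂ) by push_cast; rfl,
      ← Complex.ofReal_cpow (by positivity), ← Real.sqrt_eq_rpow, hsq]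
    push_cast
    rw [one_div_div]
  · congr 1
    rw [Equiv.neg_apply]
    push_cast
    rw [← mul_assoc, Complex.I_mul_I]
    field_simp
    ring

/-- Poisson summation for the Gaussian on the two-dimensional torus. -/
lemma tsum_gauss_torus {R v : ℝ} (hR : 0 < R) (hv : 0 < v) (x : T2) :
    ∑' n : ℤ × ℤ, ((exp (-(dot2 (freq R n) (freq R n) * v ^ 2)) : ℝ) : ℂ) *
        Complex.exp (Complex.I * ((dot2 x (freq R n) : ℝ) : ℂ)) =
      ((∑' m : ℤ × ℤ, R ^ 2 / (4 * π) * ((v ^ 2)⁻¹ *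
        exp (-(dot2 (x + lat R m) (x + lat R m) / 4 / v ^ 2))) : ℝ) : ℂ) := by
  have hv2 : 0 < v ^ 2 := by positivity
  have h1 := tsum_gauss_circle hR hv2 x.1
  have h2 := tsum_gauss_circle hR hv2 x.2
  have hsum : ∀ y : ℝ, Summable fun n : ℤ => ‖((exp (-(v ^ 2 * (2 * π * n / R) ^ 2)) : ℝ) : ℂ) *
      Complex.exp (Complex.I * ((y * (2 * π * n / R) : ℝ) : ℂ))‖ := by
    intro y
    have := summable_exp_neg_sq (c := v ^ 2 * (2 * π / R) ^ 2) (by positivity)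
    refine this.congr fun n => ?_
    rw [norm_mul, Complex.norm_exp_I_mul_ofReal, mul_one, Complex.norm_real,
      Real.norm_of_nonneg (exp_pos _).le]
    congr 1; ring
  have hsum' : ∀ y : ℝ, Summable fun m : ℤ =>
      ‖R / √(4 * π * v ^ 2) * exp (-((y + R * m) ^ 2 / (4 * v ^ 2)))‖ := by
    intro y
    apply Summable.norm
    apply Summable.mul_left
    obtain ⟨hs, -⟩ := summable_exp_neg_abs_progression (c := 1) hR one_pos y
    refine Summable.of_nonneg_of_le (fun _ => (exp_pos _).le) (fun m => ?_)
      (hs.mul_left (exp (v ^ 2)))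
    rw [← exp_add]
    apply exp_le_exp.2
    rw [← sq_abs]
    have : |y + R * m| ^ 2 / (4 * v ^ 2) - |y + R * m| + v ^ 2
        = (|y + R * m| / (2 * v) - v) ^ 2 := by field_simp; ring
    nlinarith [sq_nonneg (|y + R * m| / (2 * v) - v)]
  have e1 := tsum_mul_tsum_of_summable_norm (hsum x.1) (hsum x.2)
  have e2 := tsum_mul_tsum_of_summable_norm (hsum' x.1) (hsum' x.2)
  rw [h1, h2, ← Complex.ofReal_mul, e2] at e1
  rw [show (∑' n : ℤ × ℤ, ((exp (-(dot2 (freq R n) (freq R n) * v ^ 2)) : ℝ) : ℂ) *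
        Complex.exp (Complex.I * ((dot2 x (freq R n) : ℝ) : ℂ))) = _ from
      tsum_congr fun n => ?_, ← e1]
  · congr 1
    refine tsum_congr fun m => ?_
    rw [mul_mul_mul_comm, ← exp_add, ← mul_assoc]
    congr 1
    · rw [div_mul_div_comm, Real.mul_self_sqrt (by positivity)]
      field_simp
    · congr 1
      simp only [dot2, lat, Prod.fst_add, Prod.snd_add]
      field_simp
      ring
  · simp only [Complex.ofReal_exp, ← Complex.exp_add]
    congr 1
    simp only [dot2, freq]
    push_cast
    ring

/-- Symbol-side sum for the operator `Λ⁻¹ e^{-τΛ}` on the torus. -/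
def kgSum (R : ℝ) (x : T2) (τ : ℂ) : ℂ :=
  ∑' n : ℤ × ℤ, Complex.exp (-(τ * (lam (freq R n) : ℝ))) / (lam (freq R n) : ℝ) *
    Complex.exp (Complex.I * ((dot2 x (freq R n) : ℝ) : ℂ))

/-- The square root `√(τ² + |z|²)` with positive real part. -/
def kgRho (τ : ℂ) (z : T2) : ℂ := (τ ^ 2 + (dot2 z z : ℝ)) ^ ((2 : ℕ) : ℂ)⁻¹

/-- The kernel of `Λ⁻¹ e^{-τΛ}` on the plane, up to a factor `2π`. -/
def kgKernel (τ : ℂ) (z : T2) : ℂ := Complex.exp (-kgRho τ z) / kgRho τ z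

lemma kgRho_arg_mem_slitPlane {τ : ℂ} (hτ : 0 < τ.re) (z : T2) :
    τ ^ 2 + ((dot2 z z : ℝ) : ℂ) ∈ Complex.slitPlane := by
  rw [Complex.mem_slitPlane_iff]
  simp only [sq, Complex.add_re, Complex.mul_re, Complex.ofReal_re, Complex.add_im, Complex.mul_im,
    Complex.ofReal_im, add_zero]
  by_cases h : τ.im = 0
  · left
    have := dot2_self_nonneg z
    rw [h]; nlinarith
  · right
    have : τ.re * τ.im ≠ 0 := mul_ne_zero hτ.ne' h
    intro h'
    apply this
    linarith

lemma kgRho_sq (τ : ℂ) (z : T2) : kgRho τ z ^ 2 = τ ^ 2 + ((dot2 z z : ℝ) : ℂ) :=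
  Complex.cpow_nat_inv_pow _ two_ne_zero

lemma kgRho_re_pos {τ : ℂ} (hτ : 0 < τ.re) (z : T2) : 0 < (kgRho τ z).re := by
  have hs := kgRho_arg_mem_slitPlane hτ z
  rw [kgRho, Complex.cpow_def_of_ne_zero (Complex.slitPlane_ne_zero hs), Complex.exp_re]
  apply mul_pos (exp_pos _)
  have him : (Complex.log (τ ^ 2 + ((dot2 z z : ℝ) : ℂ)) * ((2 : ℕ) : ℂ)⁻¹).im =
      Complex.arg (τ ^ 2 + ((dot2 z z : ℝ) : ℂ)) / 2 := by
    rw [show (((2 : ℕ) : ℂ)⁻¹) = ((2⁻¹ : ℝ) : ℂ) by push_cast; rfl, Complex.im_mul_ofReal,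
      Complex.log_im]
    ring
  rw [him]
  have h1 := Complex.neg_pi_lt_arg (τ ^ 2 + ((dot2 z z : ℝ) : ℂ))
  have h2 : Complex.arg (τ ^ 2 + ((dot2 z z : ℝ) : ℂ)) < π :=
    lt_of_le_of_ne (Complex.arg_le_pi _) (Complex.mem_slitPlane_iff_arg.1 hs).1
  exact Real.cos_pos_of_mem_Ioo ⟨by linarith, by linarith⟩

lemma kgRho_re_im {τ : ℂ} (z : T2) :
    (kgRho τ z).re ^ 2 - (kgRho τ z).im ^ 2 = τ.re ^ 2 - τ.im ^ 2 + dot2 z z ∧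
      (kgRho τ z).re * (kgRho τ z).im = τ.re * τ.im := by
  have h := kgRho_sq τ z
  have h1 := congrArg Complex.re h
  have h2 := congrArg Complex.im h
  simp only [sq, Complex.add_re, Complex.mul_re, Complex.ofReal_re, Complex.add_im, Complex.mul_im,
    Complex.ofReal_im, add_zero] at h1 h2
  constructor
  · nlinarith
  · linarith

lemma re_le_kgRho_re {τ : ℂ} (hτ : 0 < τ.re) (z : T2) : τ.re ≤ (kgRho τ z).re := by
  obtain ⟨h1, h2⟩ := kgRho_re_im (τ := τ) z
  have hp := kgRho_re_pos hτ z
  have hq := dot2_self_nonneg z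
  by_contra! hlt
  have h3 : ((kgRho τ z).re * (kgRho τ z).im) ^ 2 = (τ.re * τ.im) ^ 2 := by rw [h2]
  have h4 : (kgRho τ z).re ^ 2 < τ.re ^ 2 := by nlinarith
  have h5 : (kgRho τ z).im ^ 2 < τ.im ^ 2 := by nlinarith
  have h6 : (kgRho τ z).re ^ 2 * (kgRho τ z).im ^ 2 < τ.re ^ 2 * τ.im ^ 2 := by
    have := sq_nonneg (kgRho τ z).im
    have h7 : 0 < (kgRho τ z).re ^ 2 := by positivity
    nlinarith
  rw [mul_pow, mul_pow] at h3
  linarith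

lemma half_en_le_kgRho_re {τ : ℂ} (hτ : 0 < τ.re) {z : T2} (hz : 2 * |τ.im| ≤ en z) :
    1 / 2 * en z ≤ (kgRho τ z).re := by
  obtain ⟨h1, h2⟩ := kgRho_re_im (τ := τ) z
  have hp := kgRho_re_pos hτ z
  rw [← en_sq z] at h1
  have h3 : 4 * τ.im ^ 2 ≤ en z ^ 2 := by
    have := pow_le_pow_left₀ (by positivity) hz 2
    rw [mul_pow, sq_abs] at this
    linarith
  by_contra! hlt
  have := sq_nonneg (kgRho τ z).im
  nlinarith [sq_nonneg τ.re, en_nonneg z]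

lemma norm_kgKernel (τ : ℂ) (z : T2) :
    ‖kgKernel τ z‖ = exp (-(kgRho τ z).re) / ‖kgRho τ z‖ := by
  rw [kgKernel, norm_div, Complex.norm_exp, Complex.neg_re]

lemma norm_kgKernel_le_of_abs_im_le {τ : ℂ} (hτ : 0 < τ.re) {M : ℝ} (hM : |τ.im| ≤ M) (z : T2) :
    ‖kgKernel τ z‖ ≤ exp M / τ.re * exp (-(1 / 2 * en z)) := by
  have hp := kgRho_re_pos hτ z
  have hle : τ.re ≤ ‖kgRho τ z‖ :=
    (re_le_kgRho_re hτ z).trans ((le_abs_self _).trans (Complex.abs_re_le_norm _))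
  rw [norm_kgKernel, div_mul_eq_mul_div, ← exp_add]
  apply div_le_div₀ (exp_pos _).le (exp_le_exp.2 _) hτ hle
  have hM0 : 0 ≤ M := (abs_nonneg _).trans hM
  rcases le_total (2 * |τ.im|) (en z) with h | h
  · have := half_en_le_kgRho_re hτ h
    linarith
  · linarith

lemma norm_kgKernel_le_of_im_pos {τ : ℂ} (hτ : 0 < τ.re) (hτ3 : τ.re ≤ 3) (hi : 0 < τ.im) (z : T2) :
    ‖kgKernel τ z‖ ≤ 9 / (τ.re * τ.im) * exp (-(1 / (τ.im + 2) * en z)) := by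
  have hp := kgRho_re_pos hτ z
  obtain ⟨-, h2⟩ := kgRho_re_im (τ := τ) z
  have hab : 0 < τ.re * τ.im := mul_pos hτ hi
  have hr := en_nonneg z
  rw [norm_kgKernel]
  rcases le_total (2 * |τ.im|) (en z) with h | h
  · have h3 := half_en_le_kgRho_re hτ h
    rw [abs_of_pos hi] at h
    have hn : τ.im ≤ ‖kgRho τ z‖ :=
      (by linarith : τ.im ≤ (kgRho τ z).re).trans
        ((le_abs_self _).trans (Complex.abs_re_le_norm _))
    have h4 : exp (-(kgRho τ z).re) ≤ exp (-(1 / (τ.im + 2) * en z)) := by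
      apply exp_le_exp.2
      have : 1 / (τ.im + 2) * en z ≤ 1 / 2 * en z :=
        mul_le_mul_of_nonneg_right (one_div_le_one_div_of_le two_pos (by linarith)) hr
      linarith
    calc exp (-(kgRho τ z).re) / ‖kgRho τ z‖ ≤ exp (-(1 / (τ.im + 2) * en z)) / τ.im :=
          div_le_div₀ (exp_pos _).le h4 hi hn
      _ = 1 / τ.im * exp (-(1 / (τ.im + 2) * en z)) := by ring
      _ ≤ 9 / (τ.re * τ.im) * exp (-(1 / (τ.im + 2) * en z)) := by
          apply mul_le_mul_of_nonneg_right _ (exp_pos _).le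
          rw [div_le_div_iff₀ hi hab]
          nlinarith
  · rw [abs_of_pos hi] at h
    have him : 0 < (kgRho τ z).im := by
      by_contra! hc
      nlinarith
    have hn : (kgRho τ z).im ≤ ‖kgRho τ z‖ := (le_abs_self _).trans (Complex.abs_im_le_norm _)
    have h4 : exp (-(kgRho τ z).re) ≤ 1 / (kgRho τ z).re := by
      rw [exp_neg, one_div]
      exact inv_anti₀ hp (by linarith [add_one_le_exp (kgRho τ z).re])
    have h5 : (1 / 9 : ℝ) ≤ exp (-(1 / (τ.im + 2) * en z)) := by
      have h6 : 1 / (τ.im + 2) * en z ≤ 2 := by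
        rw [one_div, inv_mul_le_iff₀ (by linarith)]
        linarith
      have h7 : exp 2 ≤ 9 := by
        have := Real.exp_one_lt_d9
        have h8 : exp 2 = exp 1 * exp 1 := by rw [← exp_add]; norm_num
        rw [h8]
        nlinarith [exp_pos 1]
      calc (1 / 9 : ℝ) ≤ (exp 2)⁻¹ := by
            rw [one_div]; exact inv_anti₀ (exp_pos _) h7
        _ = exp (-2) := (exp_neg 2).symm
        _ ≤ _ := exp_le_exp.2 (by linarith)
    calc exp (-(kgRho τ z).re) / ‖kgRho τ z‖ ≤ (1 / (kgRho τ z).re) / (kgRho τ z).im :=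
          div_le_div₀ (by positivity) h4 him hn
      _ = 1 / (τ.re * τ.im) := by rw [div_div, h2]
      _ = 9 / (τ.re * τ.im) * (1 / 9) := by ring
      _ ≤ _ := mul_le_mul_of_nonneg_left h5 (by positivity)

lemma summable_kgKernel {R : ℝ} (hR : 0 < R) {τ : ℂ} (hτ : 0 < τ.re) (x : T2) :
    Summable fun m : ℤ × ℤ => kgKernel τ (x + lat R m) :=
  Summable.of_norm_bounded
    ((summable_exp_neg_en_lat hR (by norm_num : (0 : ℝ) < 1 / 2) x).1.mul_left _)
    fun m => norm_kgKernel_le_of_abs_im_le hτ le_rfl _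

lemma norm_exp_neg_mul_lam_div_le {δ : ℝ} {τ : ℂ} (hτ : δ ≤ τ.re) (R : ℝ) (x : T2) (n : ℤ × ℤ) :
    ‖Complex.exp (-(τ * (lam (freq R n) : ℝ))) / (lam (freq R n) : ℝ) *
      Complex.exp (Complex.I * ((dot2 x (freq R n) : ℝ) : ℂ))‖ ≤ exp (-(δ * lam (freq R n))) := by
  rw [norm_mul, Complex.norm_exp_I_mul_ofReal, mul_one, norm_div, Complex.norm_real,
    Real.norm_of_nonneg (lam_pos _).le, Complex.norm_exp, Complex.neg_re, Complex.re_mul_ofReal]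
  apply (div_le_self (exp_pos _).le (one_le_lam _)).trans
  exact exp_le_exp.2 (neg_le_neg (mul_le_mul_of_nonneg_right hτ (lam_pos _).le))

lemma differentiableOn_kgSum {R : ℝ} (hR : 0 < R) (x : T2) {δ : ℝ} (hδ : 0 < δ) :
    DifferentiableOn ℂ (kgSum R x) {τ : ℂ | δ < τ.re} := by
  refine Complex.differentiableOn_tsum_of_summable_norm (summable_exp_neg_lam hR hδ).1
    (fun n => ?_) (isOpen_lt continuous_const Complex.continuous_re)
    (fun n τ hτ => norm_exp_neg_mul_lam_div_le (le_of_lt hτ) R x n)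
  fun_prop

lemma differentiableAt_kgKernel {τ : ℂ} (hτ : 0 < τ.re) (z : T2) :
    DifferentiableAt ℂ (fun τ => kgKernel τ z) τ := by
  have h1 : DifferentiableAt ℂ (fun τ => kgRho τ z) τ := by
    unfold kgRho
    exact DifferentiableAt.cpow (by fun_prop) (by fun_prop) (kgRho_arg_mem_slitPlane hτ z)
  have h2 : kgRho τ z ≠ 0 := by
    intro h
    have := kgRho_re_pos hτ z
    rw [h] at this
    simp at this
  unfold kgKernel
  exact (h1.neg.cexp).div h1 h2

lemma differentiableOn_tsum_kgKernel {R : ℝ} (hR : 0 < R) (x : T2) {δ : ℝ} (hδ : 0 < δ) (M : ℝ) :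
    DifferentiableOn ℂ (fun τ => ∑' m : ℤ × ℤ, kgKernel τ (x + lat R m))
      {τ : ℂ | δ < τ.re ∧ |τ.im| < M} := by
  refine Complex.differentiableOn_tsum_of_summable_norm
    (u := fun m => exp M / δ * exp (-(1 / 2 * en (x + lat R m))))
    ((summable_exp_neg_en_lat hR (by norm_num : (0 : ℝ) < 1 / 2) x).1.mul_left _)
    (fun n τ hτ => (differentiableAt_kgKernel (hδ.trans hτ.1) _).differentiableWithinAt)
    ((isOpen_lt continuous_const Complex.continuous_re).inter
      (isOpen_lt (continuous_abs.comp Complex.continuous_im) continuous_const))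
    (fun n τ hτ => ?_)
  refine (norm_kgKernel_le_of_abs_im_le (hδ.trans hτ.1) hτ.2.le _).trans ?_
  apply mul_le_mul_of_nonneg_right _ (exp_pos _).le
  exact div_le_div_of_nonneg_left (exp_pos _).le hδ hτ.1.le

lemma kgRho_ofReal (τ : ℝ) (z : T2) : kgRho τ z = (√(τ ^ 2 + dot2 z z) : ℝ) := by
  rw [kgRho, Real.sqrt_eq_rpow,
    Complex.ofReal_cpow (add_nonneg (sq_nonneg _) (dot2_self_nonneg z))]
  push_cast
  norm_num

lemma kgKernel_ofReal (τ : ℝ) (z : T2) :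
    kgKernel τ z = (exp (-√(τ ^ 2 + dot2 z z)) / √(τ ^ 2 + dot2 z z) : ℝ) := by
  rw [kgKernel, kgRho_ofReal]
  push_cast
  rfl

lemma kgSum_ofReal {R τ : ℝ} (hR : 0 < R) (hτ : 0 < τ) (x : T2) :
    kgSum R x τ = (R ^ 2 / (2 * π) : ℝ) * ∑' m : ℤ × ℤ, kgKernel τ (x + lat R m) := by
  have hτ2 : 0 < τ / 2 := by positivity
  have hρ : ∀ z : T2, 0 < √(τ ^ 2 + dot2 z z) := fun z =>
    Real.sqrt_pos.2 (add_pos_of_pos_of_nonneg (by positivity) (dot2_self_nonneg z))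
  have hρ2 : ∀ z : T2, √(τ ^ 2 + dot2 z z) ^ 2 = τ ^ 2 + dot2 z z := fun z =>
    Real.sq_sqrt (add_nonneg (sq_nonneg _) (dot2_self_nonneg z))
  have hπ : (√π : ℝ) ≠ 0 := (Real.sqrt_pos.2 pi_pos).ne'
  -- the frequency side
  have hF := fun n : ℤ × ℤ => (integral_exp_neg_sq_add_inv_sq (lam_pos (freq R n)) hτ2).1
  have hsF : Summable fun n : ℤ × ℤ => √π / (2 * lam (freq R n)) *
      exp (-(2 * lam (freq R n) * (τ / 2))) := by
    refine Summable.of_nonneg_of_le (fun n => ?_) (fun n => ?_)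
      ((summable_exp_neg_lam hR hτ).1.mul_left (√π))
    · have := lam_pos (freq R n)
      positivity
    · have h1 := one_le_lam (freq R n)
      rw [show 2 * lam (freq R n) * (τ / 2) = τ * lam (freq R n) by ring]
      exact mul_le_mul_of_nonneg_right (div_le_self (by positivity) (by linarith)) (exp_pos _).le
  have hnF : ∀ (n : ℤ × ℤ) (v : ℝ),
      ‖((exp (-(lam (freq R n) ^ 2 * v ^ 2 + (τ / 2) ^ 2 / v ^ 2)) : ℝ) : ℂ) *
        Complex.exp (Complex.I * ((dot2 x (freq R n) : ℝ) : ℂ))‖ =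
      exp (-(lam (freq R n) ^ 2 * v ^ 2 + (τ / 2) ^ 2 / v ^ 2)) := fun n v => by
    rw [norm_mul, Complex.norm_exp_I_mul_ofReal, mul_one, Complex.norm_real,
      Real.norm_of_nonneg (exp_pos _).le]
  have hLs := hasSum_integral_of_summable_integral_norm (μ := volume.restrict (Ioi (0 : ℝ)))
    (F := fun (n : ℤ × ℤ) (v : ℝ) =>
      ((exp (-(lam (freq R n) ^ 2 * v ^ 2 + (τ / 2) ^ 2 / v ^ 2)) : ℝ) : ℂ) *
        Complex.exp (Complex.I * ((dot2 x (freq R n) : ℝ) : ℂ)))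
    (fun n => ((hF n).1.ofReal).mul_const _)
    (by simpa only [hnF, (hF _).2] using hsF)
  -- the space side
  have hG := fun m : ℤ × ℤ => (integral_exp_neg_sq_add_inv_sq one_pos
    (half_pos (hρ (x + lat R m)))).2
  have hsG : Summable fun m : ℤ × ℤ => R ^ 2 / (4 * π) *
      (√π / (2 * (√(τ ^ 2 + dot2 (x + lat R m) (x + lat R m)) / 2)) *
        exp (-(2 * 1 * (√(τ ^ 2 + dot2 (x + lat R m) (x + lat R m)) / 2)))) := by
    have h := (summable_kgKernel hR (τ := (τ : ℂ)) (by simpa using hτ) x).norm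
    refine (h.mul_left (R ^ 2 / (4 * π) * √π)).congr fun m => ?_
    rw [kgKernel_ofReal, Complex.norm_real, Real.norm_of_nonneg
      (div_nonneg (exp_pos _).le (hρ _).le)]
    rw [show ∀ r : ℝ, 2 * 1 * (r / 2) = r by intro r; ring,
      show ∀ r : ℝ, 2 * (r / 2) = r by intro r; ring]
    ring
  have hnG : ∀ (m : ℤ × ℤ) (v : ℝ), ‖R ^ 2 / (4 * π) * ((v ^ 2)⁻¹ * exp (-((1 : ℝ) ^ 2 * v ^ 2 +
        (√(τ ^ 2 + dot2 (x + lat R m) (x + lat R m)) / 2) ^ 2 / v ^ 2)))‖ =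
      R ^ 2 / (4 * π) * ((v ^ 2)⁻¹ * exp (-((1 : ℝ) ^ 2 * v ^ 2 +
        (√(τ ^ 2 + dot2 (x + lat R m) (x + lat R m)) / 2) ^ 2 / v ^ 2))) := fun m v =>
    Real.norm_of_nonneg (by positivity)
  have hRs := hasSum_integral_of_summable_integral_norm (μ := volume.restrict (Ioi (0 : ℝ)))
    (F := fun (m : ℤ × ℤ) (v : ℝ) => R ^ 2 / (4 * π) * ((v ^ 2)⁻¹ * exp (-((1 : ℝ) ^ 2 * v ^ 2 +
        (√(τ ^ 2 + dot2 (x + lat R m) (x + lat R m)) / 2) ^ 2 / v ^ 2))))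
    (fun m => (hG m).1.const_mul _)
    (by simpa only [hnG, integral_const_mul, (hG _).2] using hsG)
  have hLt := hLs.tsum_eq
  have hRt := congrArg (fun r : ℝ => (r : ℂ)) hRs.tsum_eq
  have hE : (∫ v in Ioi (0 : ℝ), ∑' n : ℤ × ℤ,
      ((exp (-(lam (freq R n) ^ 2 * v ^ 2 + (τ / 2) ^ 2 / v ^ 2)) : ℝ) : ℂ) *
        Complex.exp (Complex.I * ((dot2 x (freq R n) : ℝ) : ℂ))) =
      ((∫ v in Ioi (0 : ℝ), ∑' m : ℤ × ℤ, R ^ 2 / (4 * π) * ((v ^ 2)⁻¹ * exp (-((1 : ℝ) ^ 2 * v ^ 2 +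
        (√(τ ^ 2 + dot2 (x + lat R m) (x + lat R m)) / 2) ^ 2 / v ^ 2))) : ℝ) : ℂ) := by
    rw [← integral_complex_ofReal]
    refine setIntegral_congr_fun measurableSet_Ioi fun v hv => ?_
    have hv0 : (0 : ℝ) < v := hv
    have hc := congrArg (fun w => ((exp (-(v ^ 2 + (τ / 2) ^ 2 / v ^ 2)) : ℝ) : ℂ) * w)
      (tsum_gauss_torus hR hv0 x)
    simp only [← tsum_mul_left, ← Complex.ofReal_mul] at hc
    convert hc using 1
    · refine tsum_congr fun n => ?_
      rw [← mul_assoc, ← Complex.ofReal_mul, ← Real.exp_add, lam_sq]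
      congr 4
      ring
    · congr 1
      refine tsum_congr fun m => ?_
      rw [div_pow, hρ2, show -((1 : ℝ) ^ 2 * v ^ 2 +
        (τ ^ 2 + dot2 (x + lat R m) (x + lat R m)) / 2 ^ 2 / v ^ 2) =
        -(v ^ 2 + (τ / 2) ^ 2 / v ^ 2) + -(dot2 (x + lat R m) (x + lat R m) / 4 / v ^ 2) by ring,
        Real.exp_add]
      ring
  rw [hE, ← hRt] at hLt
  have hs2 : (√π / 2 : ℝ) * kgSum R x τ = ∑' n : ℤ × ℤ, ∫ v in Ioi (0 : ℝ),
      ((exp (-(lam (freq R n) ^ 2 * v ^ 2 + (τ / 2) ^ 2 / v ^ 2)) : ℝ) : ℂ) *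
        Complex.exp (Complex.I * ((dot2 x (freq R n) : ℝ) : ℂ)) := by
    rw [kgSum, ← tsum_mul_left]
    refine tsum_congr fun n => ?_
    rw [integral_mul_const, integral_complex_ofReal, (hF n).2]
    rw [show 2 * lam (freq R n) * (τ / 2) = τ * lam (freq R n) by ring]
    have := (lam_pos (freq R n)).ne'
    push_cast
    field_simp
  have hs3 : ((∑' m : ℤ × ℤ, ∫ v in Ioi (0 : ℝ), R ^ 2 / (4 * π) * ((v ^ 2)⁻¹ *
      exp (-((1 : ℝ) ^ 2 * v ^ 2 +
        (√(τ ^ 2 + dot2 (x + lat R m) (x + lat R m)) / 2) ^ 2 / v ^ 2))) : ℝ) : ℂ) =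
      (R ^ 2 / (4 * π) * √π : ℝ) * ∑' m : ℤ × ℤ, kgKernel τ (x + lat R m) := by
    rw [Complex.ofReal_tsum, ← tsum_mul_left]
    refine tsum_congr fun m => ?_
    rw [integral_const_mul, (hG m).2, kgKernel_ofReal, ← Complex.ofReal_mul]
    congr 1
    rw [show ∀ r : ℝ, 2 * 1 * (r / 2) = r by intro r; ring,
      show ∀ r : ℝ, 2 * (r / 2) = r by intro r; ring]
    ring
  rw [hs3, ← hs2] at hLt
  have h0 : ((√π / 2 : ℝ) : ℂ) ≠ 0 := by
    exact_mod_cast div_ne_zero hπ two_ne_zero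
  apply mul_left_cancel₀ h0
  rw [hLt, ← mul_assoc, ← Complex.ofReal_mul]
  congr 2
  field_simp
  norm_num

/-- Poisson summation for `Λ⁻¹ e^{-τΛ}` in the right half-plane. -/
lemma kgSum_eq_tsum_kgKernel {R : ℝ} (hR : 0 < R) (x : T2) {τ : ℂ} (hτ : 0 < τ.re) :
    kgSum R x τ = (R ^ 2 / (2 * π) : ℝ) * ∑' m : ℤ × ℤ, kgKernel τ (x + lat R m) := by
  set δ := τ.re / 2 with hδd
  have hδ : 0 < δ := half_pos hτ
  set M := |τ.im| + 1 with hMd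
  have hM : 0 < M := by positivity
  set U : Set ℂ := {τ : ℂ | δ < τ.re ∧ |τ.im| < M} with hU
  have hUo : IsOpen U := (isOpen_lt continuous_const Complex.continuous_re).inter
    (isOpen_lt (Complex.continuous_im.abs) continuous_const)
  have hUc : Convex ℝ U := by
    have : U = {τ : ℂ | δ < τ.re} ∩ ({τ : ℂ | -M < τ.im} ∩ {τ : ℂ | τ.im < M}) := by
      ext z
      simp [hU, abs_lt]
    rw [this]
    exact (convex_halfSpace_re_gt δ).inter ((convex_halfSpace_im_gt _).inter
      (convex_halfSpace_im_lt _))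
  have h1 : AnalyticOnNhd ℂ (kgSum R x) U :=
    ((differentiableOn_kgSum hR x hδ).mono fun z hz => hz.1).analyticOnNhd hUo
  have h2 : AnalyticOnNhd ℂ (fun τ => (R ^ 2 / (2 * π) : ℝ) *
      ∑' m : ℤ × ℤ, kgKernel τ (x + lat R m)) U :=
    ((differentiableOn_tsum_kgKernel hR x hδ M).const_mul _).analyticOnNhd hUo
  have hz0 : ((τ.re : ℝ) : ℂ) ∈ U := by
    simp only [hU, mem_ofPred_eq, Complex.ofReal_re, Complex.ofReal_im, abs_zero]
    exact ⟨by linarith, hM⟩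
  refine h1.eqOn_of_preconnected_of_frequently_eq h2 hUc.isPreconnected hz0 ?_
    (show τ ∈ U from ⟨by linarith, by linarith⟩)
  have ht : Filter.Tendsto (fun s : ℝ => (s : ℂ)) (nhdsWithin τ.re {τ.re}ᶜ)
      (nhdsWithin ((τ.re : ℝ) : ℂ) {((τ.re : ℝ) : ℂ)}ᶜ) :=
    Complex.continuous_ofReal.continuousAt.continuousWithinAt.tendsto_nhdsWithin
      fun s hs h => hs (Complex.ofReal_injective h)
  refine ht.frequently (Filter.Eventually.frequently ?_)
  have : ∀ᶠ s in nhdsWithin τ.re {τ.re}ᶜ, 0 < s := (lt_mem_nhds hτ).filter_mono nhdsWithin_le_nhds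
  filter_upwards [this] with s hs
  exact kgSum_ofReal hR hs x

lemma norm_kgSum_le {R : ℝ} (hR : 0 < R) (x : T2) {τ : ℂ} (hτ : 0 < τ.re) (hτ3 : τ.re ≤ 3)
    (hi : 0 < τ.im) :
    ‖kgSum R x τ‖ ≤ R ^ 2 / (2 * π) *
      (9 / (τ.re * τ.im) * (2 * (1 + 2 * (τ.im + 2) / R)) ^ 2) := by
  have hc : 0 < 1 / (τ.im + 2) := by positivity
  obtain ⟨hs, hle⟩ := summable_exp_neg_en_lat hR hc x
  have hpi : 0 ≤ R ^ 2 / (2 * π) := by positivity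
  rw [kgSum_eq_tsum_kgKernel hR x hτ, norm_mul, Complex.norm_real, Real.norm_of_nonneg hpi]
  refine mul_le_mul_of_nonneg_left ?_ hpi
  refine (tsum_of_norm_bounded (hs.mul_left (9 / (τ.re * τ.im))).hasSum
    fun m => norm_kgKernel_le_of_im_pos hτ hτ3 hi _).trans ?_
  rw [tsum_mul_left]
  refine mul_le_mul_of_nonneg_left (hle.trans_eq ?_) (by positivity)
  congr 3
  field_simp

/-- Symbol-side sum for `e^{-τΛ}` on the torus. -/
def expSum (R : ℝ) (x : T2) (τ : ℂ) : ℂ :=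
  ∑' n : ℤ × ℤ, Complex.exp (-(τ * (lam (freq R n) : ℝ))) *
    Complex.exp (Complex.I * ((dot2 x (freq R n) : ℝ) : ℂ))

lemma deriv_kgSum {R : ℝ} (hR : 0 < R) (x : T2) {τ : ℂ} (hτ : 0 < τ.re) :
    deriv (kgSum R x) τ = -expSum R x τ := by
  have h := Complex.hasSum_deriv_of_summable_norm (summable_exp_neg_lam hR (half_pos hτ)).1
    (F := fun (n : ℤ × ℤ) (τ : ℂ) => Complex.exp (-(τ * (lam (freq R n) : ℝ))) /
      (lam (freq R n) : ℝ) * Complex.exp (Complex.I * ((dot2 x (freq R n) : ℝ) : ℂ)))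
    (fun n => by fun_prop)
    (isOpen_lt continuous_const Complex.continuous_re)
    (fun n w hw => norm_exp_neg_mul_lam_div_le (le_of_lt hw) R x n)
    (show τ ∈ {w : ℂ | τ.re / 2 < w.re} from half_lt_self hτ)
  change deriv (fun τ => ∑' n : ℤ × ℤ, Complex.exp (-(τ * (lam (freq R n) : ℝ))) /
      (lam (freq R n) : ℝ) * Complex.exp (Complex.I * ((dot2 x (freq R n) : ℝ) : ℂ))) τ = _
  rw [← h.tsum_eq, expSum, ← tsum_neg]
  refine tsum_congr fun n => ?_
  have hl : ((lam (freq R n) : ℝ) : ℂ) ≠ 0 := by exact_mod_cast (lam_pos _).ne'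
  have hd : HasDerivAt (fun w : ℂ => Complex.exp (-(w * (lam (freq R n) : ℝ))) /
      (lam (freq R n) : ℝ) * Complex.exp (Complex.I * ((dot2 x (freq R n) : ℝ) : ℂ)))
      (Complex.exp (-(τ * (lam (freq R n) : ℝ))) * (-(1 * (lam (freq R n) : ℝ))) /
      (lam (freq R n) : ℝ) * Complex.exp (Complex.I * ((dot2 x (freq R n) : ℝ) : ℂ))) τ :=
    ((((hasDerivAt_id τ).mul_const _).neg.cexp).div_const _).mul_const _
  rw [hd.deriv]
  field_simp

lemma norm_expSum_le_of_one_le_im {R : ℝ} (hR : 1 < R) (x : T2) {τ : ℂ} (hτ : 0 < τ.re)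
    (hτ2 : τ.re ≤ 2) (hi : 1 ≤ τ.im) :
    ‖expSum R x τ‖ ≤ 3136 * R ^ 2 / τ.re ^ 2 * (τ.im⁻¹ * (τ.im / R + 1) ^ 2) := by
  have hR0 : 0 < R := by linarith
  set a := τ.re with ha
  set b := τ.im with hb
  have hb0 : 0 < b := by linarith
  have hball : ∀ w ∈ Metric.closedBall τ (a / 4), 3 / 4 * a ≤ w.re ∧ w.re ≤ 3 ∧ b / 2 ≤ w.im ∧
      w.im ≤ b + 1 := fun w hw => by
    rw [mem_closedBall_iff_norm] at hw
    have h1 := abs_le.1 ((Complex.abs_re_le_norm _).trans hw)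
    have h2 := abs_le.1 ((Complex.abs_im_le_norm _).trans hw)
    simp only [Complex.sub_re, Complex.sub_im, ← ha, ← hb] at h1 h2
    exact ⟨by linarith, by linarith, by linarith, by linarith⟩
  have hd : DiffContOnCl ℂ (kgSum R x) (Metric.ball τ (a / 4)) := by
    have := differentiableOn_kgSum hR0 x (half_pos hτ)
    refine (this.mono fun w hw => ?_).diffContOnCl
    have := (hball w (Metric.closure_ball_subset_closedBall hw)).1
    simp only [mem_ofPred_eq]
    linarith
  have key := Complex.norm_deriv_le_of_forall_mem_sphere_norm_le
    (C := R ^ 2 / (2 * 3) * (9 / (3 / 4 * a * (b / 2)) * (2 * (7 * (b / R + 1))) ^ 2))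
    (by positivity : 0 < a / 4) hd fun w hw => by
      obtain ⟨h1, h2, h3, h4⟩ := hball w (Metric.sphere_subset_closedBall hw)
      have hw1 : 0 < w.re := by linarith
      have hw2 : 0 < w.im := by linarith
      refine (norm_kgSum_le hR0 x hw1 h2 hw2).trans ?_
      have h5 : 1 + 2 * (w.im + 2) / R ≤ 7 * (b / R + 1) := by
        have : 2 * (w.im + 2) / R ≤ 2 * (b / R) + 6 := by
          rw [div_le_iff₀ hR0, add_mul, mul_assoc, div_mul_cancel₀ _ hR0.ne']
          linarith
        have : 0 ≤ b / R := by positivity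
        linarith
      have h6 := pi_gt_three.le
      gcongr
  rw [deriv_kgSum hR0 x hτ, norm_neg] at key
  refine key.trans_eq ?_
  field_simp
  norm_num

lemma norm_expSum_le {R : ℝ} (hR : 1 < R) (x : T2) {τ : ℂ} (hτ : 0 < τ.re)
    (hτ2 : τ.re ≤ 2) (hi : 0 ≤ τ.im) :
    ‖expSum R x τ‖ ≤ 6272 * R ^ 2 / τ.re ^ 2 * ((1 + τ.im)⁻¹ * (τ.im / R + 1) ^ 2) := by
  have hR0 : 0 < R := by linarith
  rcases le_total 1 τ.im with h | h
  · refine (norm_expSum_le_of_one_le_im hR x hτ hτ2 h).trans ?_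
    have hb0 : 0 < τ.im := by linarith
    have : τ.im⁻¹ ≤ 2 * (1 + τ.im)⁻¹ := by
      rw [← div_eq_mul_inv, inv_le_comm₀ hb0 (by positivity), inv_div]
      linarith
    calc _ ≤ 3136 * R ^ 2 / τ.re ^ 2 * (2 * (1 + τ.im)⁻¹ * (τ.im / R + 1) ^ 2) := by gcongr
      _ = _ := by ring
  · obtain ⟨hs, hle⟩ := summable_exp_neg_lam hR0 hτ
    have h1 : ‖expSum R x τ‖ ≤ (2 * (1 + R / (π * τ.re))) ^ 2 := by
      refine (tsum_of_norm_bounded hs.hasSum fun n => ?_).trans hle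
      rw [norm_mul, Complex.norm_exp_I_mul_ofReal, mul_one, Complex.norm_exp, Complex.neg_re,
        Complex.re_mul_ofReal]
    have h2 : 1 + R / (π * τ.re) ≤ 3 * (R / τ.re) := by
      have h3 : R / (π * τ.re) ≤ R / τ.re :=
        div_le_div_of_nonneg_left hR0.le hτ (le_mul_of_one_le_left hτ.le (by linarith [pi_gt_three]))
      have h4 : 1 ≤ 2 * (R / τ.re) := by
        rw [← mul_div_assoc, le_div_iff₀ hτ]; linarith
      linarith
    have h5 : 1 / 2 ≤ (1 + τ.im)⁻¹ := by
      rw [one_div]; exact inv_anti₀ (by positivity) (by linarith)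
    have h6 : 1 ≤ (τ.im / R + 1) ^ 2 := one_le_pow₀ (by have : 0 ≤ τ.im / R := by positivity
                                                        linarith)
    calc _ ≤ (2 * (1 + R / (π * τ.re))) ^ 2 := h1
      _ ≤ (2 * (3 * (R / τ.re))) ^ 2 := by gcongr
      _ = 72 * R ^ 2 / τ.re ^ 2 * (1 / 2 * 1) := by ring
      _ ≤ _ := by gcongr; norm_num

section FourierRepresentation
open scoped FourierTransform

lemma exists_fourier_representation {f : T2 → ℂ} (hf : ContDiff ℝ (⊤ : ℕ∞) f)
    (hs : ∀ x, 3 / 2 ≤ en x → f x = 0) :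
    ∃ ψ : EuclideanSpace ℝ (Fin 2) → ℂ, Integrable ψ ∧ ∀ η : T2,
      f η = ∫ v, ψ v * Complex.exp (Complex.I *
        ((dot2 ((2 * π * v 0, 2 * π * v 1) : T2) η : ℝ) : ℂ)) := by
  have hg : HasCompactSupport fun v : EuclideanSpace ℝ (Fin 2) => f (v 0, v 1) := by
    refine HasCompactSupport.intro (isCompact_closedBall 0 (3 / 2)) fun v hv => hs _ ?_
    rw [mem_closedBall_zero_iff, not_le, EuclideanSpace.norm_eq, Fin.sum_univ_two] at hv
    refine hv.le.trans_eq ?_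
    simp [en, dot2, sq]
  have hg2 : ContDiff ℝ (⊤ : ℕ∞) fun v : EuclideanSpace ℝ (Fin 2) => f (v 0, v 1) :=
    hf.comp (by fun_prop)
  let g := hg.toSchwartzMap hg2
  refine ⟨(𝓕 g : SchwartzMap _ _), (𝓕 g : SchwartzMap _ _).integrable, fun η => ?_⟩
  have h : (𝓕⁻ (𝓕 g : SchwartzMap _ _) : SchwartzMap _ _) (!₂[η.1, η.2]) = f η := by
    rw [FourierTransform.fourierInv_fourier_eq]
    simp [g]
  rw [← h, SchwartzMap.fourierInv_coe, Real.fourierInv_eq']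
  congr 1
  funext v
  rw [smul_eq_mul, mul_comm]
  congr 2
  rw [mul_comm]
  congr 2
  simp [dot2, PiLp.inner_apply, Fin.sum_univ_two]
  ring

end FourierRepresentation

/-- A character of the torus. -/
def echar (R : ℝ) (n : ℤ × ℤ) (x : T2) : ℂ :=
  Complex.exp (Complex.I * ((dot2 x (freq R n) : ℝ) : ℂ))

lemma norm_echar (R : ℝ) (n : ℤ × ℤ) (x : T2) : ‖echar R n x‖ = 1 :=
  Complex.norm_exp_I_mul_ofReal _

lemma echar_add (R : ℝ) (n : ℤ × ℤ) (x y : T2) :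
    echar R n (x + y) = echar R n x * echar R n y := by
  rw [echar, echar, echar, ← Complex.exp_add, ← mul_add, ← Complex.ofReal_add]
  congr 3
  simp only [dot2, Prod.fst_add, Prod.snd_add]
  ring

/-- An absolutely convergent trigonometric series. -/
def trig (R : ℝ) (a : ℤ × ℤ → ℂ) (x : T2) : ℂ := ∑' n, a n * echar R n x

lemma summable_mul_echar {R : ℝ} {a : ℤ × ℤ → ℂ} (ha : Summable a) (x : T2) :
    Summable fun n => a n * echar R n x :=
  Summable.of_norm (by simpa only [norm_mul, norm_echar, mul_one] using ha.norm)

/-- The Fourier multiplier `m` is bounded by `B` for the uniform norm on trigonometric series. -/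
def IsUniformMultiplier (R : ℝ) (m : ℤ × ℤ → ℂ) (B : ℝ) : Prop :=
  ∀ a : ℤ × ℤ → ℂ, Summable a → ∀ S : ℝ, (∀ x, ‖trig R a x‖ ≤ S) →
    Summable (fun n => m n * a n) ∧ ∀ x, ‖trig R (fun n => m n * a n) x‖ ≤ B * S

namespace IsUniformMultiplier
variable {R : ℝ} {m m' : ℤ × ℤ → ℂ} {B B' : ℝ}

lemma norm_le (h : IsUniformMultiplier R m B) (n : ℤ × ℤ) : ‖m n‖ ≤ B := by
  classical
  have ht : ∀ (c : ℤ × ℤ → ℂ) (x : T2), trig R (fun k => c k * (Pi.single n 1 : ℤ × ℤ → ℂ) k) x =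
      c n * echar R n x := fun c x => by
    rw [trig, tsum_eq_single n fun k hk => by simp [Pi.single_eq_of_ne hk]]
    simp
  have hs : Summable (Pi.single n 1 : ℤ × ℤ → ℂ) := (hasSum_pi_single n 1).summable
  have := (h _ hs 1 fun x => by
    have := ht 1 x
    simp only [Pi.one_apply, one_mul] at this
    rw [this, norm_echar]).2 0
  rwa [ht, norm_mul, norm_echar, mul_one, mul_one] at this

lemma nonneg (h : IsUniformMultiplier R m B) : 0 ≤ B := (norm_nonneg _).trans (h.norm_le 0)

lemma mul (h : IsUniformMultiplier R m B) (h' : IsUniformMultiplier R m' B') :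
    IsUniformMultiplier R (fun n => m n * m' n) (B * B') := fun a ha S hS => by
  obtain ⟨h1, h2⟩ := h' a ha S hS
  have := h _ h1 _ h2
  simpa only [mul_assoc] using this

lemma add (h : IsUniformMultiplier R m B) (h' : IsUniformMultiplier R m' B') :
    IsUniformMultiplier R (fun n => m n + m' n) (B + B') := fun a ha S hS => by
  obtain ⟨h1, h2⟩ := h a ha S hS
  obtain ⟨h3, h4⟩ := h' a ha S hS
  simp only [add_mul]
  refine ⟨h1.add h3, fun x => ?_⟩
  have : trig R (fun n => m n * a n + m' n * a n) x =
      trig R (fun n => m n * a n) x + trig R (fun n => m' n * a n) x := by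
    simp only [trig, add_mul]
    exact (summable_mul_echar h1 x).tsum_add (summable_mul_echar h3 x)
  rw [this]
  exact (norm_add_le _ _).trans (add_le_add (h2 x) (h4 x))

lemma const (R : ℝ) (c : ℂ) : IsUniformMultiplier R (fun _ => c) ‖c‖ := fun a ha S hS => by
  refine ⟨ha.mul_left c, fun x => ?_⟩
  have : trig R (fun n => c * a n) x = c * trig R a x := by
    simp only [trig, mul_assoc]
    exact tsum_mul_left
  rw [this, norm_mul]
  exact mul_le_mul_of_nonneg_left (hS x) (norm_nonneg _)

lemma mono (h : IsUniformMultiplier R m B) (hB : B ≤ B') : IsUniformMultiplier R m B' :=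
  fun a ha S hS => ⟨(h a ha S hS).1, fun x => ((h a ha S hS).2 x).trans
    (mul_le_mul_of_nonneg_right hB ((norm_nonneg _).trans (hS 0)))⟩

lemma pow (h : IsUniformMultiplier R m B) (j : ℕ) :
    IsUniformMultiplier R (fun n => m n ^ j) (B ^ j) := by
  induction j with
  | zero => simpa using const R 1
  | succ j ih => simpa only [pow_succ] using ih.mul h

lemma tsum {m : ℕ → ℤ × ℤ → ℂ} {B : ℕ → ℝ} (h : ∀ j, IsUniformMultiplier R (m j) (B j))
    (hB : Summable B) : IsUniformMultiplier R (fun n => ∑' j, m j n) (∑' j, B j) := by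
  intro a ha S hS
  have hm : ∀ n, Summable fun j => m j n := fun n =>
    Summable.of_norm_bounded hB fun j => (h j).norm_le n
  have hle : ∀ n, ‖∑' j, m j n‖ ≤ ∑' j, B j := fun n =>
    tsum_of_norm_bounded hB.hasSum fun j => (h j).norm_le n
  refine ⟨Summable.of_norm_bounded (ha.norm.mul_left (∑' j, B j)) fun n => ?_, fun x => ?_⟩
  · rw [norm_mul]
    exact mul_le_mul_of_nonneg_right (hle n) (norm_nonneg _)
  · have hsum : Summable (Function.uncurry fun (n : ℤ × ℤ) (j : ℕ) =>
        m j n * a n * echar R n x) := by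
      refine Summable.of_norm_bounded (ha.norm.mul_of_nonneg hB (fun _ => norm_nonneg _)
        fun j => (h j).nonneg) fun q => ?_
      rw [Function.uncurry, norm_mul, norm_mul, norm_echar, mul_one, mul_comm]
      exact mul_le_mul_of_nonneg_left ((h _).norm_le _) (norm_nonneg _)
    have hx : trig R (fun n => (∑' j, m j n) * a n) x =
        ∑' j, trig R (fun n => m j n * a n) x := by
      simp only [trig]
      rw [hsum.tsum_comm]
      refine tsum_congr fun n => ?_
      rw [← tsum_mul_right, ← tsum_mul_right]
    rw [hx, ← tsum_mul_right]
    exact tsum_of_norm_bounded (hB.mul_right S).hasSum fun j => (h j a ha S hS).2 x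

lemma of_integral {V : Type*} [MeasurableSpace V] {ν : Measure V} {ψ : V → ℂ}
    (hψ : Integrable ψ ν) {y : V → T2} (hy : Measurable y) :
    IsUniformMultiplier R (fun n => ∫ v, ψ v * echar R n (y v) ∂ν) (∫ v, ‖ψ v‖ ∂ν) := by
  intro a ha S hS
  have hle : ∀ n, ‖∫ v, ψ v * echar R n (y v) ∂ν‖ ≤ ∫ v, ‖ψ v‖ ∂ν := fun n =>
    (norm_integral_le_integral_norm _).trans_eq (by simp only [norm_mul, norm_echar, mul_one])
  have hem : ∀ n, Measurable fun v => echar R n (y v) := fun n => by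
    unfold echar dot2
    fun_prop
  have hint : ∀ n, Integrable (fun v => ψ v * echar R n (y v)) ν := fun n =>
    hψ.mul_bdd (c := 1) (hem n).aestronglyMeasurable
      (Filter.Eventually.of_forall fun v => (norm_echar _ _ _).le)
  refine ⟨Summable.of_norm_bounded (ha.norm.mul_left (∫ v, ‖ψ v‖ ∂ν)) fun n => ?_, fun x => ?_⟩
  · rw [norm_mul]
    exact mul_le_mul_of_nonneg_right (hle n) (norm_nonneg _)
  · have h := hasSum_integral_of_summable_integral_norm (μ := ν)
      (F := fun (n : ℤ × ℤ) v => a n * echar R n x * (ψ v * echar R n (y v)))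
      (fun n => (hint n).const_mul _)
      (by
        simp only [norm_mul, norm_echar, mul_one, integral_const_mul]
        exact ha.norm.mul_right _)
    have hx : trig R (fun n => (∫ v, ψ v * echar R n (y v) ∂ν) * a n) x =
        ∫ v, ψ v * trig R a (x + y v) ∂ν := by
      rw [trig]
      convert h.tsum_eq using 1
      · refine tsum_congr fun n => ?_
        rw [integral_const_mul]
        ring
      · congr 1
        funext v
        rw [trig, ← tsum_mul_left]
        refine tsum_congr fun n => ?_
        rw [echar_add]
        ring
    rw [hx, ← integral_mul_const]
    refine norm_integral_le_of_norm_le (hψ.norm.mul_const S) (Filter.Eventually.of_forall fun v => ?_)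
    rw [norm_mul]
    exact mul_le_mul_of_nonneg_left (hS _) (norm_nonneg _)

end IsUniformMultiplier

lemma exists_isUniformMultiplier {f : T2 → ℂ} (hf : ContDiff ℝ (⊤ : ℕ∞) f)
    (hs : ∀ x, 3 / 2 ≤ en x → f x = 0) :
    ∃ B : ℝ, ∀ R c : ℝ, IsUniformMultiplier R (fun n => f (c • freq R n)) B := by
  obtain ⟨ψ, hψ, h⟩ := exists_fourier_representation hf hs
  refine ⟨∫ v, ‖ψ v‖, fun R c => ?_⟩
  have := IsUniformMultiplier.of_integral (R := R) hψ
    (y := fun v => ((c * (2 * π * v 0), c * (2 * π * v 1)) : T2)) (by fun_prop)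
  convert this using 2 with n
  rw [h]
  congr 1
  funext v
  rw [echar]
  congr 4
  simp only [dot2, Prod.smul_fst, Prod.smul_snd, smul_eq_mul]
  ring

lemma en_smul (c : ℝ) (z : T2) : en (c • z) = |c| * en z := by
  rw [en, en, ← Real.sqrt_sq_eq_abs, ← Real.sqrt_mul (sq_nonneg c)]
  congr 1
  simp only [dot2, Prod.smul_fst, Prod.smul_snd, smul_eq_mul]
  ring

lemma cutoff_rescaled_eq_one_of_phiK_ne_zero {φ : T2 → ℝ} (hφ : IsCutoff φ) {k : ℤ} {ξ : T2}
    (h : phiK φ k ξ ≠ 0) : φ ((2 : ℝ) ^ (-k - 2) • ξ) = 1 := by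
  obtain ⟨-, -, h1, h0⟩ := hφ
  apply h1
  have h2 : (2 : ℝ) ^ (-k - 2) = 2 ^ (-k) / 4 := by
    rw [zpow_sub₀ two_ne_zero]; norm_num
  have h3 : (2 : ℝ) ^ (-(k - 1)) = 2 ^ (-k) * 2 := by
    rw [show -(k - 1) = -k + 1 by ring, zpow_add₀ two_ne_zero]; norm_num
  have hp : (0 : ℝ) < 2 ^ (-k) := by positivity
  have hlt : en ((2 : ℝ) ^ (-k) • ξ) < 3 / 2 := by
    by_contra! hle
    apply h
    rw [phiK, h0 _ hle, h0 _ _, sub_zero]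
    rw [h3, en_smul, abs_of_pos (by positivity)]
    rw [en_smul, abs_of_pos hp] at hle
    linarith
  rw [en_smul, abs_of_pos hp] at hlt
  rw [h2, en_smul, abs_of_pos (by positivity)]
  linarith

lemma isUniformMultiplier_phiK {φ : T2 → ℝ} {R B : ℝ}
    (hB : ∀ c : ℝ, IsUniformMultiplier R (fun n => ((φ (c • freq R n) : ℝ) : ℂ)) B) (k : ℤ) :
    IsUniformMultiplier R (fun n => ((phiK φ k (freq R n) : ℝ) : ℂ)) (2 * B) := by
  have h := (hB (2 ^ (-k))).add
    ((IsUniformMultiplier.const R (-1)).mul (hB (2 ^ (-(k - 1)))))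
  convert h using 2 with n
  · rw [phiK]; push_cast; ring
  · rw [norm_neg, norm_one]; ring

lemma summable_pow_div_two_mul_factorial {b : ℝ} (hb : 0 ≤ b) :
    Summable fun j : ℕ => b ^ j / ((2 * j).factorial : ℝ) := by
  refine Summable.of_nonneg_of_le (fun j => by positivity) (fun j => ?_)
    (Real.summable_pow_div_factorial b)
  gcongr
  omega

lemma trig_exp_neg (R : ℝ) (x : T2) (τ : ℂ) :
    trig R (fun n => Complex.exp (-(τ * (lam (freq R n) : ℝ)))) x = expSum R x τ := rfl

lemma summable_cexp_neg_lam {R : ℝ} (hR : 0 < R) {τ : ℂ} (hτ : 0 < τ.re) :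
    Summable fun n : ℤ × ℤ => Complex.exp (-(τ * (lam (freq R n) : ℝ))) := by
  refine Summable.of_norm_bounded (summable_exp_neg_lam hR hτ).1 fun n => ?_
  rw [Complex.norm_exp, Complex.neg_re, Complex.re_mul_ofReal]

/-- `φ_k` is a bounded multiplier after multiplication by `cosh (εΛ)` when `ε 2^k ≤ 1`. -/
lemma exists_isUniformMultiplier_cosh {φ : T2 → ℝ} (hφ : IsCutoff φ) :
    ∃ B : ℝ, ∀ (R ε : ℝ) (k : ℤ), 0 ≤ ε → ε ≤ 1 → ε * 2 ^ k ≤ 1 →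
      IsUniformMultiplier R (fun n => ((phiK φ k (freq R n) : ℝ) : ℂ)) B ∧
      IsUniformMultiplier R
        (fun n => ((cosh (ε * lam (freq R n)) * phiK φ k (freq R n) : ℝ) : ℂ)) B := by
  obtain ⟨B₀, hB₀⟩ := exists_isUniformMultiplier (f := fun ξ => ((φ ξ : ℝ) : ℂ))
    (Complex.ofRealCLM.contDiff.comp hφ.1) fun x hx => by rw [hφ.2.2.2 x hx, Complex.ofReal_zero]
  obtain ⟨B₁, hB₁⟩ := exists_isUniformMultiplier (f := fun ξ => ((dot2 ξ ξ * φ ξ : ℝ) : ℂ))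
    (Complex.ofRealCLM.contDiff.comp (ContDiff.mul (by unfold dot2; fun_prop) hφ.1))
    fun x hx => by rw [hφ.2.2.2 x hx, mul_zero, Complex.ofReal_zero]
  have hB₀0 : 0 ≤ B₀ := (hB₀ 1 0).nonneg
  have hB₁0 : 0 ≤ B₁ := (hB₁ 1 0).nonneg
  set b := B₀ + 16 * B₁ with hb
  have hb0 : 0 ≤ b := by positivity
  set D := ∑' j : ℕ, b ^ j / ((2 * j).factorial : ℝ) with hD
  have hD0 : 0 ≤ D := tsum_nonneg fun j => by positivity
  refine ⟨2 * B₀ + D * (2 * B₀), fun R ε k hε hε1 hεk => ?_⟩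
  have hk := isUniformMultiplier_phiK (hB₀ R) k
  refine ⟨hk.mono (by nlinarith [mul_nonneg hD0 hB₀0]), ?_⟩
  set w : ℤ × ℤ → ℝ := fun n => ε ^ 2 * φ ((2 : ℝ) ^ (-k - 2) • freq R n) +
    (4 * (ε * 2 ^ k)) ^ 2 * (dot2 ((2 : ℝ) ^ (-k - 2) • freq R n) ((2 : ℝ) ^ (-k - 2) • freq R n) *
      φ ((2 : ℝ) ^ (-k - 2) • freq R n)) with hw
  have hwm : IsUniformMultiplier R (fun n => (w n : ℂ)) b := by
    have h := ((IsUniformMultiplier.const R ((ε ^ 2 : ℝ) : ℂ)).mul (hB₀ R (2 ^ (-k - 2)))).add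
      ((IsUniformMultiplier.const R (((4 * (ε * 2 ^ k)) ^ 2 : ℝ) : ℂ)).mul (hB₁ R (2 ^ (-k - 2))))
    have h2 := h.mono (B' := b) ?_
    · convert h2 using 2 with n
      rw [hw]
      push_cast
      ring
    · rw [Complex.norm_real, Complex.norm_real, Real.norm_of_nonneg (by positivity),
        Real.norm_of_nonneg (by positivity)]
      have h3 : ε ^ 2 ≤ 1 := pow_le_one₀ hε hε1
      have h4 : (ε * 2 ^ k) ^ 2 ≤ 1 := pow_le_one₀ (by positivity) hεk
      have h5 : (4 * (ε * 2 ^ k)) ^ 2 ≤ 16 := by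
        rw [mul_pow]; linarith
      rw [hb]
      gcongr
      exact mul_le_of_le_one_left hB₀0 h3
  have hc : IsUniformMultiplier R
      (fun n => ∑' j : ℕ, ((((2 * j).factorial : ℝ)⁻¹ : ℝ) : ℂ) * (w n : ℂ) ^ j) D := by
    refine IsUniformMultiplier.tsum (B := fun j => b ^ j / ((2 * j).factorial : ℝ))
      (fun j => ?_) (summable_pow_div_two_mul_factorial hb0)
    refine ((IsUniformMultiplier.const R _).mul (hwm.pow j)).mono ?_
    rw [Complex.norm_real, Real.norm_of_nonneg (by positivity)]
    exact (inv_mul_eq_div _ _).le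
  have hfin := (hc.mul hk).mono (B' := 2 * B₀ + D * (2 * B₀)) (by linarith)
  convert hfin using 2 with n

  by_cases h0 : phiK φ k (freq R n) = 0
  · simp [h0]
  · have h1 := cutoff_rescaled_eq_one_of_phiK_ne_zero hφ h0
    have hwn : w n = (ε * lam (freq R n)) ^ 2 := by
      rw [mul_pow, lam_sq]
      simp only [hw, h1, mul_one]
      have h2 : (2 : ℝ) ^ (-k - 2) * (4 * 2 ^ k) = 1 := by
        rw [zpow_sub₀ two_ne_zero, zpow_neg]
        have : (2 : ℝ) ^ k ≠ 0 := by positivity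
        field_simp
        norm_num
      have h3 : dot2 ((2 : ℝ) ^ (-k - 2) • freq R n) ((2 : ℝ) ^ (-k - 2) • freq R n) =
          ((2 : ℝ) ^ (-k - 2)) ^ 2 * dot2 (freq R n) (freq R n) := by
        simp only [dot2, Prod.smul_fst, Prod.smul_snd, smul_eq_mul]
        ring
      rw [h3]
      linear_combination (ε ^ 2 * dot2 (freq R n) (freq R n)) *
        ((2 : ℝ) ^ (-k - 2) * (4 * 2 ^ k) + 1) * h2
    rw [Complex.ofReal_mul, ← (Real.hasSum_cosh _).tsum_eq, Complex.ofReal_tsum]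
    congr 1
    refine tsum_congr fun j => ?_
    rw [hwn, pow_mul]
    push_cast
    rw [div_eq_inv_mul]

lemma exists_norm_trig_phiK_exp_le {φ : T2 → ℝ} (hφ : IsCutoff φ) :
    ∃ C : ℝ, 0 < C ∧ ∀ R : ℝ, 1 < R → ∀ (k : ℤ) (t : ℝ), 0 ≤ t → ∀ x : T2,
      ‖trig R (fun n => ((phiK φ k (freq R n) : ℝ) : ℂ) *
        Complex.exp (Complex.I * ((-t : ℝ) : ℂ) * ((lam (freq R n) : ℝ) : ℂ))) x‖ ≤
      R ^ 2 * (C * ((1 + t)⁻¹ * (t / R + 1) ^ 2 * (2 : ℝ) ^ (2 * kplus k))) := by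
  obtain ⟨B, hB⟩ := exists_isUniformMultiplier_cosh hφ
  have hB0 : 0 ≤ B := (hB 1 0 0 le_rfl zero_le_one (by simp)).1.nonneg
  refine ⟨3 * B * 6272 + 1, by positivity, fun R hR k t ht x => ?_⟩
  have hR0 : 0 < R := by linarith
  set ε : ℝ := 2 ^ (-kplus k) with hε
  have hε0 : 0 < ε := by positivity
  have hε1 : ε ≤ 1 := zpow_le_one_of_nonpos₀ one_le_two (by simp [kplus])
  have hεk : ε * 2 ^ k ≤ 1 := by
    rw [hε, ← zpow_add₀ two_ne_zero]
    exact zpow_le_one_of_nonpos₀ one_le_two (by simp [kplus])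
  have hε2 : (2 : ℝ) ^ (2 * kplus k) = (ε ^ 2)⁻¹ := by
    rw [hε, ← zpow_natCast, ← zpow_mul, ← zpow_neg]
    congr 1
    push_cast
    ring
  obtain ⟨hm, hmc⟩ := hB R ε k hε0.le hε1 hεk
  set Y := (1 + t)⁻¹ * (t / R + 1) ^ 2 with hY
  have hY0 : 0 ≤ Y := by positivity
  have hbd : ∀ δ : ℝ, ε ≤ δ → δ ≤ 2 → ∀ y, ‖trig R (fun n => Complex.exp
      (-(((δ : ℂ) + t * Complex.I) * (lam (freq R n) : ℝ)))) y‖ ≤ 6272 * R ^ 2 / ε ^ 2 * Y := by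
    intro δ h1 h2 y
    have hδ : 0 < δ := hε0.trans_le h1
    rw [trig_exp_neg]
    have := norm_expSum_le hR y (τ := (δ : ℂ) + t * Complex.I) (by simpa using hδ)
      (by simpa using h2) (by simpa using ht)
    simp only [Complex.add_re, Complex.ofReal_re, Complex.mul_re, Complex.I_re, mul_zero,
      Complex.ofReal_im, Complex.I_im, mul_one, sub_self, add_zero, Complex.add_im,
      Complex.mul_im, zero_add] at this
    refine this.trans ?_
    gcongr
  have hsum : ∀ δ : ℝ, ε ≤ δ → Summable (fun n => Complex.exp
      (-(((δ : ℂ) + t * Complex.I) * (lam (freq R n) : ℝ)))) := fun δ h1 =>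
    summable_cexp_neg_lam hR0 (by simpa using hε0.trans_le h1)
  obtain ⟨s1, b1⟩ := hmc _ (hsum ε le_rfl) _ (hbd ε le_rfl (by linarith))
  obtain ⟨s2, b2⟩ := hm _ (hsum (2 * ε) (by linarith)) _ (hbd (2 * ε) (by linarith) (by linarith))
  have hid : trig R (fun n => ((phiK φ k (freq R n) : ℝ) : ℂ) *
        Complex.exp (Complex.I * ((-t : ℝ) : ℂ) * ((lam (freq R n) : ℝ) : ℂ))) x =
      2 * trig R (fun n => ((cosh (ε * lam (freq R n)) * phiK φ k (freq R n) : ℝ) : ℂ) *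
        Complex.exp (-(((ε : ℂ) + t * Complex.I) * (lam (freq R n) : ℝ)))) x -
      trig R (fun n => ((phiK φ k (freq R n) : ℝ) : ℂ) *
        Complex.exp (-((((2 * ε : ℝ) : ℂ) + t * Complex.I) * (lam (freq R n) : ℝ)))) x := by
    simp only [trig]
    rw [← tsum_mul_left, ← ((summable_mul_echar s1 x).mul_left 2).tsum_sub (summable_mul_echar s2 x)]
    refine tsum_congr fun n => ?_
    simp only [Real.cosh_eq]
    push_cast
    have e1 : Complex.exp (Complex.I * -(t : ℂ) * (lam (freq R n) : ℝ)) =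
        Complex.exp ((ε : ℂ) * (lam (freq R n) : ℝ)) *
          Complex.exp (-(((ε : ℂ) + t * Complex.I) * (lam (freq R n) : ℝ))) := by
      rw [← Complex.exp_add]; ring_nf
    have e2 : Complex.exp (-((2 * (ε : ℂ) + t * Complex.I) * (lam (freq R n) : ℝ))) =
        Complex.exp (-((ε : ℂ) * (lam (freq R n) : ℝ))) *
          Complex.exp (-(((ε : ℂ) + t * Complex.I) * (lam (freq R n) : ℝ))) := by
      rw [← Complex.exp_add]; ring_nf
    rw [e1, e2]
    ring
  rw [hid, hε2]
  calc _ ≤ 2 * (B * (6272 * R ^ 2 / ε ^ 2 * Y)) + B * (6272 * R ^ 2 / ε ^ 2 * Y) := by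
        refine (norm_sub_le _ _).trans (add_le_add ?_ (b2 x))
        rw [norm_mul, Complex.norm_ofNat]
        exact mul_le_mul_of_nonneg_left (b1 x) two_pos.le
    _ = R ^ 2 * (3 * B * 6272 * (Y * (ε ^ 2)⁻¹)) := by ring
    _ ≤ _ := by
        gcongr
        linarith

section RieszThorin
open Complex.HadamardThreeLines

/-- The analytic family `a ↦ |a|^{p(1-z/2)} sgn a` used in complex interpolation. -/
def powFamily (p : ℝ) (z a : ℂ) : ℂ :=
  if a = 0 then 0 else a / ‖a‖ * (‖a‖ : ℂ) ^ ((p : ℂ) * (1 - z / 2))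

lemma differentiable_powFamily (p : ℝ) (a : ℂ) : Differentiable ℂ fun z => powFamily p z a := by
  unfold powFamily
  split_ifs with h
  · fun_prop
  · have h' : (‖a‖ : ℂ) ≠ 0 := by exact_mod_cast (norm_pos_iff.2 h).ne'
    refine Differentiable.const_mul ?_ _
    exact Differentiable.const_cpow (by fun_prop) (Or.inl h')

lemma norm_powFamily {p : ℝ} (hp : 0 < p) {z : ℂ} (hz : z.re ≤ 1) (a : ℂ) :
    ‖powFamily p z a‖ = ‖a‖ ^ (p * (1 - z.re / 2)) := by
  unfold powFamily
  split_ifs with h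
  · rw [h, norm_zero, Real.zero_rpow]
    exact (mul_pos hp (by linarith)).ne'
  · have h' : 0 < ‖a‖ := norm_pos_iff.2 h
    rw [norm_mul, norm_div, Complex.norm_real, norm_norm, div_self h'.ne', one_mul,
      Complex.norm_cpow_eq_rpow_re_of_pos h', Complex.re_ofReal_mul]
    simp

lemma powFamily_eq_self {p : ℝ} (hp : 0 < p) (a : ℂ) :
    powFamily p ((2 - 2 / p : ℝ) : ℂ) a = a := by
  unfold powFamily
  split_ifs with h
  · exact h.symm
  · have h' : (‖a‖ : ℂ) ≠ 0 := by exact_mod_cast (norm_pos_iff.2 h).ne'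
    have : (p : ℂ) * (1 - ((2 - 2 / p : ℝ) : ℂ) / 2) = 1 := by
      have : (p : ℂ) ≠ 0 := by exact_mod_cast hp.ne'
      push_cast
      field_simp
      ring
    rw [this, Complex.cpow_one, div_mul_cancel₀ _ h']

variable {α : Type*} [MeasurableSpace α] {μ : Measure α}

lemma integral_map_mul_eq_sum (f : SimpleFunc α ℂ) (h : ℂ → ℂ) {w : α → ℂ} (hw : Integrable w μ) :
    ∫ x, h (f x) * w x ∂μ = ∑ a ∈ f.range, h a * ∫ x in f ⁻¹' {a}, w x ∂μ := by
  have : ∀ x, h (f x) * w x = ∑ a ∈ f.range, h a * (f ⁻¹' {a}).indicator w x := fun x => by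
    rw [Finset.sum_eq_single (f x)]
    · rw [indicator_of_mem (by simp)]
    · intro b _ hb
      rw [indicator_of_notMem (by simpa using hb.symm), mul_zero]
    · intro hx
      exact absurd (SimpleFunc.mem_range_self f x) hx
  simp only [this]
  rw [integral_finsetSum _ fun a _ => (hw.indicator (f.measurableSet_fiber a)).const_mul _]
  refine Finset.sum_congr rfl fun a _ => ?_
  rw [integral_const_mul, integral_indicator (f.measurableSet_fiber a)]

lemma differentiable_integral_powFamily (p : ℝ) (f : SimpleFunc α ℂ) {w : α → ℂ}
    (hw : Integrable w μ) :
    Differentiable ℂ fun z => ∫ x, f.map (powFamily p z) x * w x ∂μ := by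
  have : (fun z => ∫ x, f.map (powFamily p z) x * w x ∂μ) =
      fun z => ∑ a ∈ f.range, powFamily p z a * ∫ x in f ⁻¹' {a}, w x ∂μ := by
    funext z
    simp only [SimpleFunc.map_apply]
    exact integral_map_mul_eq_sum f (powFamily p z) hw
  rw [this]
  exact Differentiable.fun_sum fun a _ => (differentiable_powFamily p a).mul_const _

lemma exists_integral_norm_powFamily_le [IsFiniteMeasure μ] {p : ℝ} (hp : 0 < p)
    (f : SimpleFunc α ℂ) : ∃ K : ℝ, ∀ z : ℂ, 0 ≤ z.re → z.re ≤ 1 →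
      ∫ x, ‖f.map (powFamily p z) x‖ ∂μ ≤ K := by
  obtain ⟨M, hM⟩ := f.exists_forall_norm_le
  refine ⟨∫ _, max 1 M ^ p ∂μ, fun z h0 h1 => ?_⟩
  refine integral_mono_of_nonneg (Filter.Eventually.of_forall fun _ => norm_nonneg _)
    (integrable_const _) (Filter.Eventually.of_forall fun x => ?_)
  simp only [SimpleFunc.map_apply, norm_powFamily hp h1]
  calc ‖f x‖ ^ (p * (1 - z.re / 2)) ≤ max 1 M ^ (p * (1 - z.re / 2)) :=
        Real.rpow_le_rpow (norm_nonneg _) ((hM x).trans (le_max_right _ _))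
          (mul_nonneg hp.le (by linarith))
    _ ≤ max 1 M ^ p := Real.rpow_le_rpow_of_exponent_le (le_max_left _ _)
        (mul_le_of_le_one_right hp.le (by linarith))

/-- Riesz–Thorin interpolation, on simple functions, for a bilinear form of finite rank bounded on
`L¹ × L¹` by `A` and on `L² × L²` by `1`. -/
lemma norm_bilin_simpleFunc_le [IsFiniteMeasure μ] {ι : Type*} (S : Finset ι) (c : ι → ℂ)
    {v w : ι → α → ℂ} (hv : ∀ n, Integrable (v n) μ) (hw : ∀ n, Integrable (w n) μ) {A p : ℝ}
    (hA : 0 ≤ A) (hp1 : 1 ≤ p) (hp2 : p ≤ 2)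
    (h1 : ∀ f g : SimpleFunc α ℂ,
      ‖∑ n ∈ S, c n * (∫ x, f x * v n x ∂μ) * ∫ x, g x * w n x ∂μ‖ ≤
        A * (∫ x, ‖f x‖ ∂μ) * ∫ x, ‖g x‖ ∂μ)
    (h2 : ∀ f g : SimpleFunc α ℂ,
      ‖∑ n ∈ S, c n * (∫ x, f x * v n x ∂μ) * ∫ x, g x * w n x ∂μ‖ ≤
        √(∫ x, ‖f x‖ ^ 2 ∂μ) * √(∫ x, ‖g x‖ ^ 2 ∂μ))
    (f g : SimpleFunc α ℂ) :
    ‖∑ n ∈ S, c n * (∫ x, f x * v n x ∂μ) * ∫ x, g x * w n x ∂μ‖ ≤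
      A ^ (2 / p - 1) * (∫ x, ‖f x‖ ^ p ∂μ) ^ (1 / p) * (∫ x, ‖g x‖ ^ p ∂μ) ^ (1 / p) := by
  have hp : 0 < p := by linarith
  set F : ℂ → ℂ := fun z => ∑ n ∈ S, c n * (∫ x, f.map (powFamily p z) x * v n x ∂μ) *
    ∫ x, g.map (powFamily p z) x * w n x ∂μ with hF
  have hFd : Differentiable ℂ F := Differentiable.fun_sum fun n _ =>
    ((differentiable_integral_powFamily p f (hv n)).const_mul _).mul
      (differentiable_integral_powFamily p g (hw n))
  set P := ∫ x, ‖f x‖ ^ p ∂μ with hP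
  set Q := ∫ x, ‖g x‖ ^ p ∂μ with hQ
  have hP0 : 0 ≤ P := integral_nonneg fun x => by positivity
  have hQ0 : 0 ≤ Q := integral_nonneg fun x => by positivity
  obtain ⟨K, hK⟩ := exists_integral_norm_powFamily_le (μ := μ) hp f
  obtain ⟨L, hL⟩ := exists_integral_norm_powFamily_le (μ := μ) hp g
  have hB : BddAbove ((norm ∘ F) '' verticalClosedStrip 0 1) := by
    refine ⟨A * K * L, ?_⟩
    rintro _ ⟨z, hz, rfl⟩
    refine (h1 _ _).trans ?_
    have hK' := hK z hz.1 hz.2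
    have hL' := hL z hz.1 hz.2
    have : 0 ≤ K := (integral_nonneg fun x => norm_nonneg _).trans hK'
    exact mul_le_mul (mul_le_mul_of_nonneg_left hK' hA) hL'
      (integral_nonneg fun x => norm_nonneg _) (mul_nonneg hA this)
  have ha : ∀ z ∈ Complex.re ⁻¹' {(0 : ℝ)}, ‖F z‖ ≤ A * P * Q := by
    intro z hz
    have hz0 : z.re = 0 := hz
    refine (h1 _ _).trans_eq ?_
    simp only [SimpleFunc.map_apply, norm_powFamily hp (hz0.le.trans zero_le_one), hz0, zero_div,
      sub_zero, mul_one]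
    rfl
  have hb : ∀ z ∈ Complex.re ⁻¹' {(1 : ℝ)}, ‖F z‖ ≤ √P * √Q := by
    intro z hz
    have hz1 : z.re = 1 := hz
    refine (h2 _ _).trans_eq ?_
    have : ∀ r : ℝ, 0 ≤ r → (r ^ (p * (1 - 1 / 2))) ^ 2 = r ^ p := fun r hr => by
      rw [← Real.rpow_natCast, ← Real.rpow_mul hr]
      congr 1
      push_cast
      ring
    simp only [SimpleFunc.map_apply, norm_powFamily hp hz1.le, hz1, this _ (norm_nonneg _)]
    rfl
  have hθ : ((2 - 2 / p : ℝ) : ℂ) ∈ verticalClosedStrip 0 1 := by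
    rw [verticalClosedStrip, mem_preimage, Complex.ofReal_re]
    constructor
    · have : 2 / p ≤ 2 := div_le_self two_pos.le hp1
      linarith
    · have : 1 ≤ 2 / p := (one_le_div hp).2 hp2
      linarith
  have key := norm_le_interp_of_mem_verticalClosedStrip₀₁' F hθ hFd.diffContOnCl hB ha hb
  have hFθ : F ((2 - 2 / p : ℝ) : ℂ) =
      ∑ n ∈ S, c n * (∫ x, f x * v n x ∂μ) * ∫ x, g x * w n x ∂μ := by
    simp only [hF, SimpleFunc.map_apply, powFamily_eq_self hp]
  rw [hFθ, Complex.ofReal_re] at key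
  refine key.trans_eq ?_
  have hsq : ∀ r : ℝ, 0 ≤ r → r ^ (1 - (2 - 2 / p)) * √r ^ (2 - 2 / p) = r ^ (1 / p) := by
    intro r hr
    rw [Real.sqrt_eq_rpow, ← Real.rpow_mul hr]
    have e : 1 / p = 1 - (2 - 2 / p) + 1 / 2 * (2 - 2 / p) := by ring
    have hpos : (0 : ℝ) < 1 / p := by positivity
    rw [e, Real.rpow_add' hr (by rw [← e]; exact hpos.ne')]
  rw [Real.mul_rpow (by positivity) hQ0, Real.mul_rpow hA hP0,
    Real.mul_rpow (Real.sqrt_nonneg _) (Real.sqrt_nonneg _), ← hsq P hP0, ← hsq Q hQ0,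
    show 2 / p - 1 = 1 - (2 - 2 / p) by ring]
  ring

end RieszThorin

section LpBounds
variable {α : Type*} [MeasurableSpace α] {μ : Measure α}

lemma norm_le_of_simpleFunc [IsFiniteMeasure μ] {p : ℝ≥0∞} (hp1 : 1 ≤ p) (hp : p ≠ ⊤)
    {L : (α → ℂ) → ℂ} {K M : ℝ} (hK0 : 0 ≤ K) (hM0 : 0 ≤ M)
    (hsub : ∀ f g, Integrable f μ → Integrable g μ → L (f - g) = L f - L g)
    (hK : ∀ f, Integrable f μ → ‖L f‖ ≤ K * ∫ x, ‖f x‖ ∂μ)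
    (hM : ∀ s : SimpleFunc α ℂ, ‖L (⇑s)‖ ≤ M * (eLpNorm (⇑s) p μ).toReal)
    {f : α → ℂ} (hf : MemLp f p μ) : ‖L f‖ ≤ M * (eLpNorm f p μ).toReal := by
  obtain ⟨D, hD⟩ : ∃ D : ℝ≥0∞, D = μ univ ^ (1 / (1 : ℝ≥0∞).toReal - 1 / p.toReal) := ⟨_, rfl⟩
  have hDt : D ≠ ⊤ := by
    rw [hD]
    refine ENNReal.rpow_ne_top_of_nonneg ?_ (measure_ne_top _ _)
    have : 1 ≤ p.toReal := by
      rw [← ENNReal.toReal_one]; exact ENNReal.toReal_mono hp hp1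
    rw [ENNReal.toReal_one, sub_nonneg, div_one]
    exact div_le_one_of_le₀ this (by linarith)
  have key : ∀ δ : ℝ, 0 < δ →
      ‖L f‖ ≤ M * (eLpNorm f p μ).toReal + δ * (K * D.toReal + M) := by
    intro δ hδ
    obtain ⟨s, hs, hsm⟩ := hf.exists_simpleFunc_eLpNorm_sub_lt hp (ENNReal.ofReal_pos.2 hδ).ne'
    have hfi := hf.integrable hp1
    have hsi := hsm.integrable hp1
    have hd := hf.sub hsm
    have hδ1 : (eLpNorm (f - ⇑s) p μ).toReal ≤ δ := ENNReal.toReal_le_of_le_ofReal hδ.le hs.le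
    have h1 : ∫ x, ‖(f - ⇑s) x‖ ∂μ ≤ δ * D.toReal := by
      have h2 := eLpNorm_le_eLpNorm_mul_rpow_measure_univ hp1 hd.1
      rw [← hD] at h2
      rw [integral_norm_eq_lintegral_enorm hd.1, ← eLpNorm_one_eq_lintegral_enorm]
      refine (ENNReal.toReal_mono (ENNReal.mul_ne_top hd.2.ne hDt) h2).trans ?_
      rw [ENNReal.toReal_mul]
      exact mul_le_mul_of_nonneg_right hδ1 ENNReal.toReal_nonneg
    have h3 : (eLpNorm (⇑s) p μ).toReal ≤ (eLpNorm f p μ).toReal + δ := by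
      have h4 : eLpNorm (⇑s) p μ ≤ eLpNorm f p μ + eLpNorm (f - ⇑s) p μ := by
        have := eLpNorm_sub_le hf.1 hd.1 hp1
        rwa [sub_sub_cancel] at this
      refine (ENNReal.toReal_mono (ENNReal.add_ne_top.2 ⟨hf.2.ne, hd.2.ne⟩) h4).trans ?_
      rw [ENNReal.toReal_add hf.2.ne hd.2.ne]
      linarith
    calc ‖L f‖ = ‖L (f - ⇑s) + L (⇑s)‖ := by rw [hsub f (⇑s) hfi hsi, sub_add_cancel]
      _ ≤ K * (δ * D.toReal) + M * ((eLpNorm f p μ).toReal + δ) :=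
        (norm_add_le _ _).trans (add_le_add
          ((hK _ (hfi.sub hsi)).trans (mul_le_mul_of_nonneg_left h1 hK0))
          ((hM s).trans (mul_le_mul_of_nonneg_left h3 hM0)))
      _ = _ := by ring
  have ht : Filter.Tendsto (fun δ : ℝ => M * (eLpNorm f p μ).toReal + δ * (K * D.toReal + M))
      (nhdsWithin 0 (Ioi 0)) (nhds (M * (eLpNorm f p μ).toReal)) := by
    have : ContinuousAt (fun δ : ℝ => M * (eLpNorm f p μ).toReal + δ * (K * D.toReal + M)) 0 := by
      fun_prop
    simpa using this.tendsto.mono_left nhdsWithin_le_nhds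
  exact ge_of_tendsto ht (eventually_mem_nhdsWithin.mono key)

lemma memLp_simpleFunc [IsFiniteMeasure μ] (p : ℝ≥0∞) (s : SimpleFunc α ℂ) : MemLp s p μ := by
  obtain ⟨M, hM⟩ := s.exists_forall_norm_le
  exact MemLp.of_bound s.aestronglyMeasurable M (Filter.Eventually.of_forall hM)

lemma toReal_eLpNorm_ofReal {p : ℝ} (hp : 0 < p) {f : α → ℂ} (hf : MemLp f (ENNReal.ofReal p) μ) :
    (eLpNorm f (ENNReal.ofReal p) μ).toReal = (∫ x, ‖f x‖ ^ p ∂μ) ^ (1 / p) := by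
  rw [hf.eLpNorm_eq_integral_rpow_norm (ENNReal.ofReal_pos.2 hp).ne' ENNReal.ofReal_ne_top,
    ENNReal.toReal_ofReal hp.le, ENNReal.toReal_ofReal (by positivity), one_div]

lemma norm_integral_mul_le_integral_norm {f w : α → ℂ} (hf : Integrable f μ)
    (hw : ∀ x, ‖w x‖ ≤ 1) : ‖∫ x, f x * w x ∂μ‖ ≤ ∫ x, ‖f x‖ ∂μ := by
  refine norm_integral_le_of_norm_le hf.norm (Filter.Eventually.of_forall fun x => ?_)
  rw [norm_mul]
  exact mul_le_of_le_one_right (norm_nonneg _) (hw x)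

variable [IsFiniteMeasure μ] {ι : Type*} (S : Finset ι) (c : ι → ℂ) {v w : ι → α → ℂ}

/-- Riesz–Thorin interpolation for a bilinear form of finite rank bounded on `L¹ × L¹` by `A` and
on `L² × L²` by `1`. -/
lemma norm_bilin_le (hv : ∀ n, Measurable (v n)) (hw : ∀ n, Measurable (w n))
    (hv1 : ∀ n x, ‖v n x‖ ≤ 1) (hw1 : ∀ n x, ‖w n x‖ ≤ 1) {A p : ℝ}
    (hA : 0 ≤ A) (hp1 : 1 ≤ p) (hp2 : p ≤ 2)
    (h1 : ∀ f g : SimpleFunc α ℂ,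
      ‖∑ n ∈ S, c n * (∫ x, f x * v n x ∂μ) * ∫ x, g x * w n x ∂μ‖ ≤
        A * (∫ x, ‖f x‖ ∂μ) * ∫ x, ‖g x‖ ∂μ)
    (h2 : ∀ f g : SimpleFunc α ℂ,
      ‖∑ n ∈ S, c n * (∫ x, f x * v n x ∂μ) * ∫ x, g x * w n x ∂μ‖ ≤
        √(∫ x, ‖f x‖ ^ 2 ∂μ) * √(∫ x, ‖g x‖ ^ 2 ∂μ))
    {f g : α → ℂ} (hf : MemLp f (ENNReal.ofReal p) μ) (hg : MemLp g (ENNReal.ofReal p) μ) :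
    ‖∑ n ∈ S, c n * (∫ x, f x * v n x ∂μ) * ∫ x, g x * w n x ∂μ‖ ≤
      A ^ (2 / p - 1) * (eLpNorm f (ENNReal.ofReal p) μ).toReal *
        (eLpNorm g (ENNReal.ofReal p) μ).toReal := by
  have hp : 0 < p := by linarith
  have hP1 : 1 ≤ ENNReal.ofReal p := ENNReal.one_le_ofReal.2 hp1
  have hib : ∀ {u : ι → α → ℂ} (_ : ∀ n, Measurable (u n)) (_ : ∀ n x, ‖u n x‖ ≤ 1) (n : ι)
      {f : α → ℂ}, Integrable f μ → Integrable (fun x => f x * u n x) μ :=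
    fun hu hu1 n f hf => hf.mul_bdd (c := 1) (hu n).aestronglyMeasurable
      (Filter.Eventually.of_forall (hu1 n))
  have hi1 : ∀ {u : ι → α → ℂ} (_ : ∀ n, Measurable (u n)) (_ : ∀ n x, ‖u n x‖ ≤ 1) (n : ι),
      Integrable (u n) μ := fun hu hu1 n =>
    (MemLp.of_bound (hu n).aestronglyMeasurable 1 (Filter.Eventually.of_forall (hu1 n))).integrable
      hP1
  have hss : ∀ s s' : SimpleFunc α ℂ,
      ‖∑ n ∈ S, c n * (∫ x, s x * v n x ∂μ) * ∫ x, s' x * w n x ∂μ‖ ≤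
      A ^ (2 / p - 1) * (eLpNorm s (ENNReal.ofReal p) μ).toReal *
        (eLpNorm s' (ENNReal.ofReal p) μ).toReal := fun s s' => by
    rw [toReal_eLpNorm_ofReal hp (memLp_simpleFunc _ s),
      toReal_eLpNorm_ofReal hp (memLp_simpleFunc _ s')]
    exact norm_bilin_simpleFunc_le S c (hi1 hv hv1) (hi1 hw hw1) hA hp1 hp2 h1 h2 s s'
  have hbd : ∀ f g : α → ℂ, Integrable f μ → Integrable g μ →
      ‖∑ n ∈ S, c n * (∫ x, f x * v n x ∂μ) * ∫ x, g x * w n x ∂μ‖ ≤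
        (∑ n ∈ S, ‖c n‖) * (∫ x, ‖f x‖ ∂μ) * ∫ x, ‖g x‖ ∂μ := fun f g hf hg => by
    refine (norm_sum_le _ _).trans ?_
    rw [mul_assoc, Finset.sum_mul]
    refine Finset.sum_le_sum fun n _ => ?_
    rw [norm_mul, norm_mul, mul_assoc]
    exact mul_le_mul_of_nonneg_left (mul_le_mul (norm_integral_mul_le_integral_norm hf (hv1 n))
      (norm_integral_mul_le_integral_norm hg (hw1 n)) (norm_nonneg _)
      (integral_nonneg fun _ => norm_nonneg _)) (norm_nonneg _)
  have hc0 : 0 ≤ ∑ n ∈ S, ‖c n‖ := Finset.sum_nonneg fun _ _ => norm_nonneg _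
  have hfs : ∀ s' : SimpleFunc α ℂ,
      ‖∑ n ∈ S, c n * (∫ x, f x * v n x ∂μ) * ∫ x, s' x * w n x ∂μ‖ ≤
      A ^ (2 / p - 1) * (eLpNorm f (ENNReal.ofReal p) μ).toReal *
        (eLpNorm s' (ENNReal.ofReal p) μ).toReal := fun s' => by
    rw [mul_right_comm]
    have hs' : Integrable s' μ := (memLp_simpleFunc (ENNReal.ofReal p) s').integrable hP1
    refine norm_le_of_simpleFunc hP1 ENNReal.ofReal_ne_top
      (L := fun f => ∑ n ∈ S, c n * (∫ x, f x * v n x ∂μ) * ∫ x, s' x * w n x ∂μ)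
      (K := (∑ n ∈ S, ‖c n‖) * ∫ x, ‖s' x‖ ∂μ) (by positivity) (by positivity)
      (fun f g hf hg => ?_) (fun f hf => ?_) (fun s => ?_) hf
    · simp only [Pi.sub_apply, sub_mul]
      rw [← Finset.sum_sub_distrib]
      refine Finset.sum_congr rfl fun n _ => ?_
      rw [integral_sub (hib hv hv1 n hf) (hib hv hv1 n hg)]
      ring
    · rw [mul_right_comm]
      exact hbd f s' hf hs'
    · rw [mul_right_comm]
      exact hss s s'
  have hfi := hf.integrable hP1
  refine norm_le_of_simpleFunc hP1 ENNReal.ofReal_ne_top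
      (L := fun g => ∑ n ∈ S, c n * (∫ x, f x * v n x ∂μ) * ∫ x, g x * w n x ∂μ)
      (K := (∑ n ∈ S, ‖c n‖) * ∫ x, ‖f x‖ ∂μ) (by positivity) (by positivity)
      (fun g g' hg hg' => ?_) (fun g hg => hbd f g hfi hg) hfs hg
  simp only [Pi.sub_apply, sub_mul]
  rw [← Finset.sum_sub_distrib]
  refine Finset.sum_congr rfl fun n _ => ?_
  rw [integral_sub (hib hw hw1 n hg) (hib hw hw1 n hg')]
  ring

/-- The duality step: a bounded function whose pairings with `L^p` are controlled is in `L^q`. -/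
lemma eLpNorm_le_of_pairing {p q : ℝ} (hp : 0 < p) (hq : 2 ≤ q) (hpq : 1 / p + 1 / q = 1)
    {h : α → ℂ} (hm : Measurable h) {H : ℝ} (hH : ∀ x, ‖h x‖ ≤ H) {M : ℝ}
    (hM0 : 0 ≤ M)
    (hM : ∀ g : α → ℂ, MemLp g (ENNReal.ofReal p) μ →
      ‖∫ x, h x * g x ∂μ‖ ≤ M * (eLpNorm g (ENNReal.ofReal p) μ).toReal) :
    eLpNorm h (ENNReal.ofReal q) μ ≤ ENNReal.ofReal M := by
  have hq0 : 0 < q := by linarith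
  have hhq : MemLp h (ENNReal.ofReal q) μ :=
    MemLp.of_bound hm.aestronglyMeasurable H (Filter.Eventually.of_forall hH)
  set g : α → ℂ := fun x => ((‖h x‖ ^ (q - 2) : ℝ) : ℂ) * (starRingEnd ℂ) (h x) with hg
  have hgm : Measurable g := by fun_prop
  have hgn : ∀ x, ‖g x‖ = ‖h x‖ ^ (q - 1) := fun x => by
    rw [hg]
    simp only [norm_mul, Complex.norm_real, RCLike.norm_conj]
    rw [Real.norm_of_nonneg (by positivity)]
    conv_lhs => rw [← Real.rpow_one ‖h x‖, ← Real.rpow_mul (norm_nonneg _), one_mul]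
    rw [← Real.rpow_add' (norm_nonneg _) (by linarith)]
    congr 1
    ring
  have hH0 : ∀ x, ‖g x‖ ≤ H ^ (q - 1) := fun x => by
    rw [hgn]
    exact Real.rpow_le_rpow (norm_nonneg _) (hH x) (by linarith)
  have hgp : MemLp g (ENNReal.ofReal p) μ :=
    MemLp.of_bound hgm.aestronglyMeasurable _ (Filter.Eventually.of_forall hH0)
  have hpq' : (q - 1) * p = q := by
    field_simp at hpq
    linarith
  set N := ∫ x, ‖h x‖ ^ q ∂μ with hN
  have hN0 : 0 ≤ N := integral_nonneg fun x => by positivity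
  have hgN : (eLpNorm g (ENNReal.ofReal p) μ).toReal = N ^ (1 / p) := by
    rw [toReal_eLpNorm_ofReal hp hgp]
    simp only [hgn, ← Real.rpow_mul (norm_nonneg _), hpq', hN]
  have hhg : ∫ x, h x * g x ∂μ = (N : ℂ) := by
    rw [hN, ← integral_complex_ofReal]
    congr 1
    funext x
    have e : h x * g x = ((‖h x‖ ^ (q - 2) * ‖h x‖ ^ 2 : ℝ) : ℂ) := by
      rw [hg]
      simp only
      rw [mul_left_comm, Complex.mul_conj, Complex.normSq_eq_norm_sq]
      push_cast
      rfl
    rw [e, ← Real.rpow_natCast, ← Real.rpow_add' (norm_nonneg _) (by push_cast; linarith)]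
    congr 2
    push_cast
    ring
  have key := hM g hgp
  rw [hhg, hgN, Complex.norm_real, Real.norm_of_nonneg hN0] at key
  rw [hhq.eLpNorm_eq_integral_rpow_norm (ENNReal.ofReal_pos.2 hq0).ne' ENNReal.ofReal_ne_top,
    ENNReal.toReal_ofReal hq0.le]
  apply ENNReal.ofReal_le_ofReal
  rcases hN0.eq_or_lt with h0 | hpos
  · rw [← hN, ← h0, Real.zero_rpow (by positivity)]
    exact hM0
  · have hpp : 0 < N ^ (1 / p) := Real.rpow_pos_of_pos hpos _
    rw [← hN, inv_eq_one_div, show 1 / q = 1 - 1 / p by linarith, Real.rpow_sub hpos, Real.rpow_one,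
      div_le_iff₀ hpp]
    exact key

end LpBounds

section TorusFourier
variable {R : ℝ}

instance isFiniteMeasure_μbox (R : ℝ) : IsFiniteMeasure (μbox R) := by
  refine ⟨?_⟩
  rw [μbox, Measure.restrict_apply_univ, box, Measure.volume_eq_prod, Measure.prod_prod]
  simp only [Real.volume_Ioc]
  exact ENNReal.mul_lt_top ENNReal.ofReal_lt_top ENNReal.ofReal_lt_top

lemma measurable_echar (R : ℝ) (n : ℤ × ℤ) : Measurable (echar R n) := by
  unfold echar dot2
  fun_prop

lemma echar_mul (R : ℝ) (m n : ℤ × ℤ) (x : T2) :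
    echar R m x * echar R n x = echar R (m + n) x := by
  rw [echar, echar, echar, ← Complex.exp_add, ← mul_add, ← Complex.ofReal_add]
  congr 3
  simp only [dot2, freq, Prod.fst_add, Prod.snd_add]
  push_cast
  ring

lemma conj_echar (R : ℝ) (n : ℤ × ℤ) (x : T2) :
    (starRingEnd ℂ) (echar R n x) = echar R (-n) x := by
  rw [echar, echar, ← Complex.exp_conj, map_mul, Complex.conj_I, Complex.conj_ofReal]
  congr 1
  simp only [dot2, freq, Prod.fst_neg, Prod.snd_neg]
  push_cast
  ring

lemma fCoeff_eq (R : ℝ) (u : T2 → ℂ) (n : ℤ × ℤ) :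
    fCoeff R u n = ∫ x, u x * echar R (-n) x ∂μbox R := by
  rw [fCoeff, μbox]
  congr 1
  funext x
  rw [← conj_echar, echar, ← Complex.exp_conj, map_mul, Complex.conj_I, Complex.conj_ofReal]

lemma integral_exp_Ioc (hR : 0 < R) (n : ℤ) :
    ∫ x in Ioc (0 : ℝ) R, Complex.exp (Complex.I * ((x * (2 * π * n / R) : ℝ) : ℂ)) =
      if n = 0 then (R : ℂ) else 0 := by
  split_ifs with h
  · simp [h, hR.le]
  · rw [← intervalIntegral.integral_of_le hR.le]
    have hc : Complex.I * ((2 * π * n / R : ℝ) : ℂ) ≠ 0 := by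
      refine mul_ne_zero Complex.I_ne_zero (Complex.ofReal_ne_zero.2 ?_)
      have : (n : ℝ) ≠ 0 := Int.cast_ne_zero.2 h
      positivity
    have he := integral_exp_mul_complex (a := 0) (b := R) hc
    have : ∀ x : ℝ, Complex.exp (Complex.I * ((x * (2 * π * n / R) : ℝ) : ℂ)) =
        Complex.exp (Complex.I * ((2 * π * n / R : ℝ) : ℂ) * x) := fun x => by
      congr 1
      push_cast
      ring
    simp only [this, he]
    have hR' : (R : ℂ) ≠ 0 := Complex.ofReal_ne_zero.2 hR.ne'
    have h1 : Complex.I * ((2 * π * n / R : ℝ) : ℂ) * R = n * (2 * π * Complex.I) := by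
      push_cast
      field_simp
    rw [h1, Complex.exp_int_mul_two_pi_mul_I]
    simp

lemma integral_echar (hR : 0 < R) (n : ℤ × ℤ) :
    ∫ x, echar R n x ∂μbox R = if n = 0 then (R : ℂ) ^ 2 else 0 := by
  have : ∀ x : T2, echar R n x = Complex.exp (Complex.I * ((x.1 * (2 * π * n.1 / R) : ℝ) : ℂ)) *
      Complex.exp (Complex.I * ((x.2 * (2 * π * n.2 / R) : ℝ) : ℂ)) := fun x => by
    rw [echar, ← Complex.exp_add, ← mul_add, ← Complex.ofReal_add, dot2, freq]
  simp only [this]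
  rw [μbox, box, Measure.volume_eq_prod, setIntegral_prod_mul
    (fun x : ℝ => Complex.exp (Complex.I * ((x * (2 * π * n.1 / R) : ℝ) : ℂ)))
    (fun x : ℝ => Complex.exp (Complex.I * ((x * (2 * π * n.2 / R) : ℝ) : ℂ))),
    integral_exp_Ioc hR, integral_exp_Ioc hR]
  obtain ⟨a, b⟩ := n
  by_cases ha : a = 0 <;> by_cases hb : b = 0 <;> simp [ha, hb, Prod.ext_iff, sq]

lemma integrable_mul_echar {f : T2 → ℂ} (hf : Integrable f (μbox R)) (n : ℤ × ℤ) :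
    Integrable (fun x => f x * echar R n x) (μbox R) :=
  hf.mul_bdd (c := 1) (measurable_echar R n).aestronglyMeasurable
    (Filter.Eventually.of_forall fun x => (norm_echar R n x).le)

lemma integrable_echar (R : ℝ) (n : ℤ × ℤ) : Integrable (echar R n) (μbox R) := by
  simpa using integrable_mul_echar (integrable_const (1 : ℂ)) n

lemma op_apply (R : ℝ) (m : T2 → ℂ) (u : T2 → ℂ) (x : T2) :
    op R m u x = (1 / (R : ℂ) ^ 2) * ∑' n, m (freq R n) * fCoeff R u n * echar R n x := rfl

lemma fCoeff_zero (R : ℝ) (n : ℤ × ℤ) : fCoeff R (0 : T2 → ℂ) n = 0 := by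
  simp [fCoeff]

lemma op_zero (R : ℝ) (m : T2 → ℂ) : op R m 0 = 0 := by
  funext x
  simp [op_apply, fCoeff_zero]

lemma fCoeff_op (hR : 0 < R) {m u : T2 → ℂ}
    (hs : Summable fun n => m (freq R n) * fCoeff R u n) (n : ℤ × ℤ) :
    fCoeff R (op R m u) n = m (freq R n) * fCoeff R u n := by
  have hR' : (R : ℂ) ^ 2 ≠ 0 := pow_ne_zero 2 (Complex.ofReal_ne_zero.2 hR.ne')
  set a : ℤ × ℤ → ℂ := fun n => m (freq R n) * fCoeff R u n with ha
  have hi : ∀ j, Integrable (fun x => a j * echar R (j + -n) x) (μbox R) := fun j =>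
    (integrable_echar R _).const_mul _
  have hsum : Summable fun j => ∫ x, ‖a j * echar R (j + -n) x‖ ∂μbox R := by
    simp only [norm_mul, norm_echar, mul_one, integral_const, smul_eq_mul]
    exact hs.norm.mul_left _
  have h := integral_tsum_of_summable_integral_norm hi hsum
  rw [fCoeff_eq]
  have h1 : ∀ x, op R m u x * echar R (-n) x =
      (1 / (R : ℂ) ^ 2) * ∑' j, a j * echar R (j + -n) x := fun x => by
    rw [op_apply, mul_assoc, ← tsum_mul_right]
    simp only [mul_assoc, ← echar_mul, ha]
  simp only [h1]
  rw [integral_const_mul, ← h, tsum_eq_single n fun j hj => by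
    rw [integral_const_mul, integral_echar hR, if_neg fun h => hj (add_neg_eq_zero.1 h), mul_zero],
    integral_const_mul, integral_echar hR, if_pos (add_neg_cancel n), mul_comm (a n), ← mul_assoc,
    one_div_mul_cancel hR', one_mul]

lemma op_eq_zero_of_not_summable {m u : T2 → ℂ}
    (hs : ¬ Summable fun n => m (freq R n) * fCoeff R u n) : op R m u = 0 := by
  funext x
  rw [op_apply, tsum_eq_zero_of_not_summable, mul_zero, Pi.zero_apply]
  refine fun h => hs (Summable.of_norm ?_)
  simpa only [norm_mul, norm_echar, mul_one] using h.norm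

/-- Bessel's inequality for finitely many Fourier modes. -/
lemma sum_norm_fCoeff_sq_le (hR : 0 < R) (S : Finset (ℤ × ℤ)) {f : T2 → ℂ}
    (hf : MemLp f 2 (μbox R)) :
    ∑ n ∈ S, ‖fCoeff R f n‖ ^ 2 ≤ R ^ 2 * ∫ x, ‖f x‖ ^ 2 ∂μbox R := by
  have hfi : Integrable f (μbox R) := hf.integrable one_le_two
  set P : T2 → ℂ := fun x => ∑ n ∈ S, fCoeff R f n * echar R n x with hP
  have hPm : Measurable P := Finset.measurable_sum _ fun n _ => (measurable_echar R n).const_mul _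
  have hPb : ∀ x, ‖P x‖ ≤ ∑ n ∈ S, ‖fCoeff R f n‖ := fun x =>
    (norm_sum_le _ _).trans_eq (by simp only [norm_mul, norm_echar, mul_one])
  have hcP : ∀ x, (starRingEnd ℂ) (P x) =
      ∑ n ∈ S, (starRingEnd ℂ) (fCoeff R f n) * echar R (-n) x := fun x => by
    simp only [hP, map_sum, map_mul, conj_echar]
  set E : ℝ := ∑ n ∈ S, ‖fCoeff R f n‖ ^ 2 with hE
  have hfP : ∫ x, f x * (starRingEnd ℂ) (P x) ∂μbox R = (E : ℂ) := by
    have : ∀ x, f x * (starRingEnd ℂ) (P x) =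
        ∑ n ∈ S, (starRingEnd ℂ) (fCoeff R f n) * (f x * echar R (-n) x) := fun x => by
      rw [hcP, Finset.mul_sum]
      exact Finset.sum_congr rfl fun n _ => by ring
    simp only [this]
    rw [integral_finsetSum _ fun n _ => (integrable_mul_echar hfi _).const_mul _, hE]
    push_cast
    refine Finset.sum_congr rfl fun n _ => ?_
    rw [integral_const_mul, ← fCoeff_eq, Complex.conj_mul']
  have hPP : ∫ x, P x * (starRingEnd ℂ) (P x) ∂μbox R = (R : ℂ) ^ 2 * (E : ℂ) := by
    have : ∀ x, P x * (starRingEnd ℂ) (P x) = ∑ n ∈ S, ∑ j ∈ S,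
        (fCoeff R f n * (starRingEnd ℂ) (fCoeff R f j)) * echar R (n + -j) x := fun x => by
      rw [hcP, hP, Finset.sum_mul_sum]
      exact Finset.sum_congr rfl fun n _ => Finset.sum_congr rfl fun j _ => by
        rw [← echar_mul]; ring
    simp only [this]
    rw [integral_finsetSum _ fun n _ => integrable_finsetSum _ fun j _ =>
      (integrable_echar R _).const_mul _, hE]
    push_cast
    rw [Finset.mul_sum]
    refine Finset.sum_congr rfl fun n hn => ?_
    rw [integral_finsetSum _ fun j _ => (integrable_echar R _).const_mul _,
      Finset.sum_eq_single n]
    · rw [integral_const_mul, integral_echar hR, if_pos (add_neg_cancel n), Complex.mul_conj']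
      ring
    · intro j _ hj
      rw [integral_const_mul, integral_echar hR,
        if_neg fun h => hj (add_neg_eq_zero.1 h).symm, mul_zero]
    · exact fun h => absurd hn h
  have hf2 : Integrable (fun x => ‖f x‖ ^ 2) (μbox R) := hf.integrable_norm_pow two_ne_zero
  have hP2 : Integrable (fun x => ‖P x‖ ^ 2) (μbox R) :=
    (MemLp.of_bound (p := 2) hPm.aestronglyMeasurable _
      (Filter.Eventually.of_forall hPb)).integrable_norm_pow two_ne_zero
  have hfPi : Integrable (fun x => f x * (starRingEnd ℂ) (P x)) (μbox R) :=
    hfi.mul_bdd (c := ∑ n ∈ S, ‖fCoeff R f n‖)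
      (Complex.continuous_conj.measurable.comp hPm).aestronglyMeasurable
      (Filter.Eventually.of_forall fun x => by rw [RCLike.norm_conj]; exact hPb x)
  have hP2v : ∫ x, ‖P x‖ ^ 2 ∂μbox R = R ^ 2 * E := by
    have h : ((∫ x, ‖P x‖ ^ 2 ∂μbox R : ℝ) : ℂ) = ((R ^ 2 * E : ℝ) : ℂ) := by
      rw [← integral_complex_ofReal]
      push_cast
      simp only [← Complex.mul_conj']
      exact hPP
    exact_mod_cast h
  have hre : ∫ x, (f x * (starRingEnd ℂ) (P x)).re ∂μbox R = E := by
    have h := integral_re hfPi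
    simp only [RCLike.re_eq_complex_re] at h
    rw [h, hfP, Complex.ofReal_re]
  have hpt : ∀ x, 0 ≤ R ^ 2 * ‖f x‖ ^ 2 - 2 * (f x * (starRingEnd ℂ) (P x)).re +
      (R ^ 2)⁻¹ * ‖P x‖ ^ 2 := fun x => by
    have h1 : (f x * (starRingEnd ℂ) (P x)).re ≤ ‖f x‖ * ‖P x‖ := by
      refine (Complex.re_le_norm _).trans ?_
      rw [norm_mul, RCLike.norm_conj]
    have h2 : 0 ≤ (R * ‖f x‖ - R⁻¹ * ‖P x‖) ^ 2 := sq_nonneg _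
    have h3 : (R * ‖f x‖ - R⁻¹ * ‖P x‖) ^ 2 =
        R ^ 2 * ‖f x‖ ^ 2 - 2 * (‖f x‖ * ‖P x‖) + (R ^ 2)⁻¹ * ‖P x‖ ^ 2 := by
      field_simp
      ring
    linarith
  have := integral_nonneg (μ := μbox R) (f := fun x => R ^ 2 * ‖f x‖ ^ 2 -
    2 * (f x * (starRingEnd ℂ) (P x)).re + (R ^ 2)⁻¹ * ‖P x‖ ^ 2) hpt
  have e : ∫ x, (R ^ 2 * ‖f x‖ ^ 2 - 2 * (f x * (starRingEnd ℂ) (P x)).re +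
      (R ^ 2)⁻¹ * ‖P x‖ ^ 2) ∂μbox R =
      R ^ 2 * (∫ x, ‖f x‖ ^ 2 ∂μbox R) - 2 * E + (R ^ 2)⁻¹ * (R ^ 2 * E) := by
    have hr : Integrable (fun x => 2 * (f x * (starRingEnd ℂ) (P x)).re) (μbox R) :=
      hfPi.re.const_mul 2
    have hd : Integrable (fun x => R ^ 2 * ‖f x‖ ^ 2 - 2 * (f x * (starRingEnd ℂ) (P x)).re)
        (μbox R) := (hf2.const_mul _).sub hr
    rw [integral_add hd (hP2.const_mul _), integral_sub (hf2.const_mul _) hr,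
      integral_const_mul, integral_const_mul, integral_const_mul, hP2v, hre]
  rw [e] at this
  have hR2 : (R ^ 2)⁻¹ * (R ^ 2 * E) = E := by field_simp
  linarith
end TorusFourier

section FiniteMultiplier
variable {R : ℝ}

lemma echar_neg_left (R : ℝ) (n : ℤ × ℤ) (x : T2) : echar R (-n) x = echar R n (-x) := by
  rw [echar, echar]
  congr 3
  simp only [dot2, freq, Prod.fst_neg, Prod.snd_neg]
  push_cast
  ring

/-- The Fourier multiplier with symbol `m` restricted to the finite set `S` of modes. -/
def finiteOp (R : ℝ) (S : Finset (ℤ × ℤ)) (m : ℤ × ℤ → ℂ) (f : T2 → ℂ) (x : T2) : ℂ :=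
  (1 / (R : ℂ) ^ 2) * ∑ n ∈ S, m n * fCoeff R f n * echar R n x

variable (S : Finset (ℤ × ℤ)) (m : ℤ × ℤ → ℂ)

lemma measurable_finiteOp (f : T2 → ℂ) : Measurable (finiteOp R S m f) :=
  (Finset.measurable_fun_sum _ fun n _ => (measurable_echar R n).const_mul _).const_mul _

variable {S m} {A : ℝ}

lemma norm_finiteOp_le (hR : 0 < R)
    (hK : ∀ x, ‖∑ n ∈ S, m n * echar R n x‖ ≤ R ^ 2 * A) {f : T2 → ℂ}
    (hf : Integrable f (μbox R)) (x : T2) :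
    ‖finiteOp R S m f x‖ ≤ A * ∫ y, ‖f y‖ ∂μbox R := by
  have h1 : ∑ n ∈ S, m n * fCoeff R f n * echar R n x =
      ∫ y, (∑ n ∈ S, m n * echar R n (x + -y)) * f y ∂μbox R := by
    have : ∀ y, (∑ n ∈ S, m n * echar R n (x + -y)) * f y =
        ∑ n ∈ S, (m n * echar R n x) * (f y * echar R (-n) y) := fun y => by
      rw [Finset.sum_mul]
      exact Finset.sum_congr rfl fun n _ => by rw [echar_add, echar_neg_left]; ring
    simp only [this]
    rw [integral_finsetSum _ fun n _ => (integrable_mul_echar hf _).const_mul _]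
    refine Finset.sum_congr rfl fun n _ => ?_
    rw [integral_const_mul, fCoeff_eq]
    ring
  have h2 : ‖∑ n ∈ S, m n * fCoeff R f n * echar R n x‖ ≤ R ^ 2 * A * ∫ y, ‖f y‖ ∂μbox R := by
    rw [h1, ← integral_const_mul]
    refine norm_integral_le_of_norm_le (hf.norm.const_mul _)
      (Filter.Eventually.of_forall fun y => ?_)
    rw [norm_mul]
    exact mul_le_mul_of_nonneg_right (hK _) (norm_nonneg _)
  have h3 : ‖(1 / (R : ℂ) ^ 2)‖ = (R ^ 2)⁻¹ := by
    rw [norm_div, norm_one, norm_pow, Complex.norm_real, Real.norm_of_nonneg hR.le, one_div]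
  rw [finiteOp, norm_mul, h3]
  calc _ ≤ (R ^ 2)⁻¹ * (R ^ 2 * A * ∫ y, ‖f y‖ ∂μbox R) := by gcongr
    _ = _ := by field_simp

lemma integral_finiteOp_mul (f : T2 → ℂ) {g : T2 → ℂ} (hg : Integrable g (μbox R)) :
    ∑ n ∈ S, (1 / (R : ℂ) ^ 2 * m n) * (∫ x, f x * echar R (-n) x ∂μbox R) *
      ∫ x, g x * echar R n x ∂μbox R = ∫ x, finiteOp R S m f x * g x ∂μbox R := by
  have : ∀ x, finiteOp R S m f x * g x =
      ∑ n ∈ S, (1 / (R : ℂ) ^ 2 * m n * fCoeff R f n) * (g x * echar R n x) := fun x => by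
    rw [finiteOp, Finset.mul_sum, Finset.sum_mul]
    exact Finset.sum_congr rfl fun n _ => by ring
  simp only [this]
  rw [integral_finsetSum _ fun n _ => (integrable_mul_echar hg _).const_mul _]
  refine Finset.sum_congr rfl fun n _ => ?_
  rw [integral_const_mul, fCoeff_eq]

lemma norm_sum_fCoeff_mul_le (hR : 0 < R) (hm : ∀ n, ‖m n‖ ≤ 1) {f g : T2 → ℂ}
    (hf : MemLp f 2 (μbox R)) (hg : MemLp g 2 (μbox R)) :
    ‖∑ n ∈ S, (1 / (R : ℂ) ^ 2 * m n) * (∫ x, f x * echar R (-n) x ∂μbox R) *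
      ∫ x, g x * echar R n x ∂μbox R‖ ≤
      √(∫ x, ‖f x‖ ^ 2 ∂μbox R) * √(∫ x, ‖g x‖ ^ 2 ∂μbox R) := by
  have h3 : ‖(1 / (R : ℂ) ^ 2)‖ = (R ^ 2)⁻¹ := by
    rw [norm_div, norm_one, norm_pow, Complex.norm_real, Real.norm_of_nonneg hR.le, one_div]
  have hB1 := sum_norm_fCoeff_sq_le hR S hf
  have hB2 : ∑ n ∈ S, ‖fCoeff R g (-n)‖ ^ 2 ≤ R ^ 2 * ∫ x, ‖g x‖ ^ 2 ∂μbox R := by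
    have := sum_norm_fCoeff_sq_le hR (S.map (Equiv.neg (ℤ × ℤ)).toEmbedding) hg
    rwa [Finset.sum_map] at this
  have hsq : ∀ a : ℝ, √(R ^ 2 * a) = R * √a := fun a => by
    rw [Real.sqrt_mul (sq_nonneg R), Real.sqrt_sq hR.le]
  calc _ ≤ ∑ n ∈ S, (R ^ 2)⁻¹ * (‖fCoeff R f n‖ * ‖fCoeff R g (-n)‖) := by
        refine (norm_sum_le _ _).trans (Finset.sum_le_sum fun n _ => ?_)
        rw [norm_mul, norm_mul, norm_mul, h3, ← fCoeff_eq, fCoeff_eq R g, neg_neg, mul_assoc,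
          mul_assoc]
        refine mul_le_mul_of_nonneg_left ?_ (by positivity)
        exact mul_le_of_le_one_left (by positivity) (hm n)
    _ = (R ^ 2)⁻¹ * ∑ n ∈ S, ‖fCoeff R f n‖ * ‖fCoeff R g (-n)‖ := (Finset.mul_sum ..).symm
    _ ≤ (R ^ 2)⁻¹ * ((R * √(∫ x, ‖f x‖ ^ 2 ∂μbox R)) * (R * √(∫ x, ‖g x‖ ^ 2 ∂μbox R))) := by
        refine mul_le_mul_of_nonneg_left ?_ (by positivity)
        refine (Real.sum_mul_le_sqrt_mul_sqrt _ _ _).trans ?_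
        rw [← hsq, ← hsq]
        gcongr
    _ = _ := by field_simp

/-- `Lᵖ → L^q` bound for a finite Fourier multiplier, interpolated between `L¹ → L^∞` and
`L² → L²`. -/
lemma LpE_finiteOp_le (hR : 0 < R) (hA : 0 ≤ A) (hm : ∀ n, ‖m n‖ ≤ 1)
    (hK : ∀ x, ‖∑ n ∈ S, m n * echar R n x‖ ≤ R ^ 2 * A) {p q : ℝ≥0∞} (hp : 1 ≤ p)
    (hpq : p ≤ q) (hd : 1 / p + 1 / q = 1) {u : T2 → ℂ} (hu : MemLp u p (μbox R)) :
    LpE R q (finiteOp R S m u) ≤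
      ENNReal.ofReal (A ^ (1 / p.toReal - 1 / q.toReal)) * LpE R p u := by
  have hui := hu.integrable hp
  rw [one_div, one_div] at hd
  rcases hp.eq_or_lt with rfl | hp'
  · have hq : q = ⊤ := by
      rw [inv_one] at hd
      have : q⁻¹ = 0 := by
        have h : (1 : ℝ≥0∞) + q⁻¹ = 1 + 0 := by rw [hd, add_zero]
        exact (ENNReal.add_right_inj ENNReal.one_ne_top).1 h
      exact ENNReal.inv_eq_zero.1 this
    subst hq
    have h1 : ∀ x, ‖finiteOp R S m u x‖ ≤ A * ∫ y, ‖u y‖ ∂μbox R := norm_finiteOp_le hR hK hui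
    simp only [ENNReal.toReal_one, ENNReal.toReal_top, div_zero, sub_zero, div_one, Real.rpow_one]
    rw [LpE, LpE, eLpNorm_exponent_top, eLpNorm_one_eq_lintegral_enorm]
    refine (eLpNormEssSup_le_of_ae_bound (Filter.Eventually.of_forall h1)).trans ?_
    rw [ENNReal.ofReal_mul hA, ofReal_integral_norm_eq_lintegral_enorm hui]
  · have hq : q ≠ ⊤ := by
      rintro rfl
      rw [ENNReal.inv_top, add_zero, ENNReal.inv_eq_one] at hd
      exact hp'.ne' hd
    have hpt : p ≠ ⊤ := (hpq.trans_lt hq.lt_top).ne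
    have hp0 : p ≠ 0 := (zero_lt_one.trans hp').ne'
    have hq0 : q ≠ 0 := fun h => hp0 (by simpa [h] using hpq)
    obtain ⟨p, hp0', rfl⟩ : ∃ r : ℝ, 0 < r ∧ p = ENNReal.ofReal r :=
      ⟨p.toReal, ENNReal.toReal_pos hp0 hpt, (ENNReal.ofReal_toReal hpt).symm⟩
    obtain ⟨q, hq0', rfl⟩ : ∃ r : ℝ, 0 < r ∧ q = ENNReal.ofReal r :=
      ⟨q.toReal, ENNReal.toReal_pos hq0 hq, (ENNReal.ofReal_toReal hq).symm⟩
    rw [ENNReal.toReal_ofReal hp0'.le, ENNReal.toReal_ofReal hq0'.le]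
    have hd' : 1 / p + 1 / q = 1 := by
      rw [← ENNReal.ofReal_inv_of_pos hp0', ← ENNReal.ofReal_inv_of_pos hq0',
        ← ENNReal.ofReal_add (by positivity) (by positivity), ENNReal.ofReal_eq_one] at hd
      simpa only [one_div] using hd
    have hpq' : p ≤ q := (ENNReal.ofReal_le_ofReal_iff hq0'.le).1 hpq
    have hp1 : 1 ≤ p := ENNReal.one_le_ofReal.1 hp
    have hinv : 1 / q ≤ 1 / p := one_div_le_one_div_of_le hp0' hpq'
    have hp2 : p ≤ 2 := by
      have h : 1 / 2 ≤ 1 / p := by linarith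
      exact (one_div_le_one_div (by norm_num) hp0').1 h
    have hq2 : 2 ≤ q := by
      have h : 1 / q ≤ 1 / 2 := by linarith
      exact (one_div_le_one_div hq0' (by norm_num)).1 h
    have hθ : 1 / p - 1 / q = 2 / p - 1 := by
      have : 2 / p = 2 * (1 / p) := by ring
      linarith
    have hb := fun (g : T2 → ℂ) (hg : MemLp g (ENNReal.ofReal p) (μbox R)) =>
      norm_bilin_le (μ := μbox R) S (fun n => 1 / (R : ℂ) ^ 2 * m n)
        (v := fun n => echar R (-n)) (w := echar R)
        (fun n => measurable_echar R _) (fun n => measurable_echar R _)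
        (fun n x => (norm_echar R _ x).le) (fun n x => (norm_echar R _ x).le) hA hp1 hp2
        (fun f g => by
          have hf1 : Integrable f (μbox R) := (memLp_simpleFunc 1 f).integrable le_rfl
          have hg1 : Integrable g (μbox R) := (memLp_simpleFunc 1 g).integrable le_rfl
          rw [integral_finiteOp_mul _ hg1, ← integral_const_mul]
          refine norm_integral_le_of_norm_le (hg1.norm.const_mul _)
            (Filter.Eventually.of_forall fun x => ?_)
          rw [norm_mul]
          exact mul_le_mul_of_nonneg_right (norm_finiteOp_le hR hK hf1 x) (norm_nonneg _))
        (fun f g => norm_sum_fCoeff_mul_le hR hm (memLp_simpleFunc 2 f) (memLp_simpleFunc 2 g))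
        hu hg
    have hM0 : 0 ≤ A ^ (2 / p - 1) * (eLpNorm u (ENNReal.ofReal p) (μbox R)).toReal := by
      positivity
    have := eLpNorm_le_of_pairing (μ := μbox R) hp0' hq2 hd' (measurable_finiteOp S m u)
      (norm_finiteOp_le hR hK hui) hM0 fun g hg => by
        rw [← integral_finiteOp_mul _ (hg.integrable hp)]
        exact hb g hg
    rw [LpE, LpE, hθ]
    rwa [ENNReal.ofReal_mul (by positivity), ENNReal.ofReal_toReal hu.2.ne] at this

end FiniteMultiplier

section DyadicSupport

lemma abs_phiK_le_one {φ : T2 → ℝ} (hφ : IsCutoff φ) (k : ℤ) (ξ : T2) : |phiK φ k ξ| ≤ 1 := by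
  have h1 := hφ.2.1 ((2 : ℝ) ^ (-k) • ξ)
  have h2 := hφ.2.1 ((2 : ℝ) ^ (-(k - 1)) • ξ)
  rw [phiK, abs_le]
  constructor <;> linarith [h1.1, h1.2, h2.1, h2.2]

lemma phiK_eq_zero {φ : T2 → ℝ} (hφ : IsCutoff φ) {k : ℤ} {ξ : T2}
    (h : 3 / 2 * (2 : ℝ) ^ k ≤ en ξ) : phiK φ k ξ = 0 := by
  have h2 : ∀ j : ℤ, j ≤ k → φ ((2 : ℝ) ^ (-j) • ξ) = 0 := fun j hj => by
    refine hφ.2.2.2 _ ?_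
    rw [en_smul, abs_of_pos (by positivity), zpow_neg, inv_mul_eq_div, le_div_iff₀ (by positivity)]
    refine le_trans ?_ h
    gcongr
    norm_num
  rw [phiK, h2 k le_rfl, h2 (k - 1) (by lia), sub_zero]

lemma exists_finset_phiK_eq_zero {φ : T2 → ℝ} (hφ : IsCutoff φ) {R : ℝ} (hR : 0 < R) (k : ℤ) :
    ∃ S : Finset (ℤ × ℤ), ∀ n ∉ S, phiK φ k (freq R n) = 0 := by
  obtain ⟨N, hN⟩ := exists_int_gt (R * (3 / 2 * (2 : ℝ) ^ k))
  refine ⟨Finset.Icc (-N) N ×ˢ Finset.Icc (-N) N, fun n hn => phiK_eq_zero hφ ?_⟩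
  have hb := half_abs_add_abs_le_en (freq R n)
  have ha : ∀ a : ℤ, |2 * π * (a : ℝ) / R| = 2 * π / R * |(a : ℝ)| := fun a => by
    rw [mul_div_right_comm, abs_mul, abs_of_pos (by positivity)]
  have key : ∀ a : ℤ, ¬ (-N ≤ a ∧ a ≤ N) →
      3 / 2 * (2 : ℝ) ^ k ≤ 1 / 2 * |2 * π * (a : ℝ) / R| := fun a h => by
    have h1 : N < |a| := by
      rw [← abs_le] at h
      exact not_le.1 h
    have h2 : (N : ℝ) < |(a : ℝ)| := by exact_mod_cast h1
    have h3 : 1 * |(a : ℝ)| ≤ π * |(a : ℝ)| := by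
      gcongr
      linarith [pi_gt_three]
    rw [ha, show 1 / 2 * (2 * π / R * |(a : ℝ)|) = π * |(a : ℝ)| / R by ring, le_div_iff₀ hR]
    linarith
  simp only [Finset.mem_product, Finset.mem_Icc, not_and_or] at hn
  refine le_trans ?_ hb
  simp only [freq]
  rcases hn with h | h
  · have := key n.1 (by rwa [not_and_or])
    linarith [abs_nonneg (2 * π * (n.2 : ℝ) / R)]
  · have := key n.2 (by rwa [not_and_or])
    linarith [abs_nonneg (2 * π * (n.1 : ℝ) / R)]

end DyadicSupport

lemma fCoeff_eq_zero_of_not_aestronglyMeasurable {R : ℝ} {u : T2 → ℂ}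
    (hu : ¬ AEStronglyMeasurable u (μbox R)) (n : ℤ × ℤ) : fCoeff R u n = 0 := by
  rw [fCoeff_eq]
  refine integral_undef fun h => hu ?_
  refine (h.aestronglyMeasurable.mul (measurable_echar R n).aestronglyMeasurable).congr
    (Filter.Eventually.of_forall fun x => ?_)
  simp only [Pi.mul_apply]
  rw [mul_assoc, echar_mul, neg_add_cancel]
  simp [echar, dot2, freq]

lemma PK_flow_eq {φ : T2 → ℝ} {R : ℝ} (hR : 0 < R) {k : ℤ} {S : Finset (ℤ × ℤ)}
    (hS : ∀ n ∉ S, phiK φ k (freq R n) = 0) {t : ℝ} {u : T2 → ℂ}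
    (hs : Summable fun n => Complex.exp (Complex.I * (t : ℂ) * ((lam (freq R n) : ℝ) : ℂ)) *
      fCoeff R u n) :
    PK R φ k (flow R t u) = finiteOp R S (fun n => ((phiK φ k (freq R n) : ℝ) : ℂ) *
      Complex.exp (Complex.I * (t : ℂ) * ((lam (freq R n) : ℝ) : ℂ))) u := by
  have hf : ∀ n, fCoeff R (flow R t u) n =
      Complex.exp (Complex.I * (t : ℂ) * ((lam (freq R n) : ℝ) : ℂ)) * fCoeff R u n :=
    fCoeff_op hR hs
  funext x
  rw [PK, op_apply, finiteOp]
  congr 1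
  simp only [hf, ← mul_assoc]
  exact tsum_eq_sum fun n hn => by
    rw [hS n hn, Complex.ofReal_zero, zero_mul, zero_mul, zero_mul]

/-- Lemma 3.1 / `dispersive`: the L^p → L^q dispersive estimate for the
Klein–Gordon propagator on the torus. -/
theorem dispersive_estimate (φ : T2 → ℝ) (hφ : IsCutoff φ) :
    ∃ C : ℝ, 0 < C ∧ ∀ R : ℝ, 1 < R → ∀ k : ℤ, ∀ t : ℝ, 0 ≤ t →
    ∀ p q : ℝ≥0∞, 1 ≤ p → p ≤ q → 1/p + 1/q = 1 →
    ∀ u : T2 → ℂ, PeriodicC R u →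
    LpE R q (PK R φ k (flow R (-t) u)) ≤
      ENNReal.ofReal (C * ((1 + t)⁻¹ * (t/R + 1) ^ 2 * (2:ℝ) ^ (2 * kplus k))
          ^ (1/p.toReal - 1/q.toReal)) * LpE R p u := by
  obtain ⟨C, hC, hbound⟩ := exists_norm_trig_phiK_exp_le hφ
  refine ⟨max C 1, by positivity, fun R hR k t ht p q hp hpq hd u _ => ?_⟩
  have hR0 : 0 < R := by linarith
  have hX : 0 < (1 + t)⁻¹ * (t / R + 1) ^ 2 * (2 : ℝ) ^ (2 * kplus k) := by positivity
  have hzero : flow R (-t) u = 0 → LpE R q (PK R φ k (flow R (-t) u)) = 0 := fun h => by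
    rw [h, PK, op_zero, LpE, eLpNorm_zero]
  by_cases hm : AEStronglyMeasurable u (μbox R)
  swap
  · rw [hzero]
    · exact zero_le
    · funext x
      simp [flow, op_apply, fCoeff_eq_zero_of_not_aestronglyMeasurable hm]
  by_cases hu : eLpNorm u p (μbox R) = ⊤
  · rw [show LpE R p u = ⊤ from hu, ENNReal.mul_top (ENNReal.ofReal_pos.2 (by positivity)).ne']
    exact le_top
  by_cases hs : Summable fun n =>
      Complex.exp (Complex.I * ((-t : ℝ) : ℂ) * ((lam (freq R n) : ℝ) : ℂ)) * fCoeff R u n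
  swap
  · rw [hzero (op_eq_zero_of_not_summable hs)]
    exact zero_le
  obtain ⟨S, hS⟩ := exists_finset_phiK_eq_zero hφ hR0 k
  rw [PK_flow_eq hR0 hS hs]
  have hq : 1 / q.toReal ≤ 1 / p.toReal ∧ 1 / p.toReal ≤ 1 := by
    have hpi : p⁻¹ ≤ 1 := ENNReal.inv_le_one.2 hp
    have hi : q⁻¹ ≤ p⁻¹ := ENNReal.inv_le_inv.2 hpq
    rw [one_div, one_div, ← ENNReal.toReal_inv, ← ENNReal.toReal_inv]
    exact ⟨ENNReal.toReal_mono (hpi.trans_lt ENNReal.one_lt_top).ne hi,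
      ENNReal.toReal_le_of_le_ofReal zero_le_one (by simpa using hpi)⟩
  have hq0 : 0 ≤ 1 / q.toReal := by positivity
  refine (LpE_finiteOp_le hR0 (mul_nonneg hC.le hX.le) (fun n => ?_) (fun x => ?_) hp hpq hd
    ⟨hm, lt_top_iff_ne_top.2 hu⟩).trans ?_
  · have he : ‖Complex.exp (Complex.I * ((-t : ℝ) : ℂ) * ((lam (freq R n) : ℝ) : ℂ))‖ = 1 := by
      rw [mul_assoc, ← Complex.ofReal_mul, Complex.norm_exp_I_mul_ofReal]
    rw [norm_mul, he, mul_one, Complex.norm_real, Real.norm_eq_abs]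
    exact abs_phiK_le_one hφ k _
  · have := hbound R hR k t ht x
    rwa [trig, tsum_eq_sum (s := S) fun n hn => by simp [hS n hn]] at this
  · gcongr
    rw [Real.mul_rpow hC.le hX.le]
    gcongr
    rcases le_total C 1 with h | h
    · exact (Real.rpow_le_one hC.le h (by linarith)).trans (le_max_right _ _)
    · refine (Real.rpow_le_rpow_of_exponent_le h (y := 1 / p.toReal - 1 / q.toReal) (z := 1)
        (by linarith)).trans ?_
      rw [Real.rpow_one]
      exact le_max_left _ _

end EP
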